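/- arXiv:2003.02107 — 4 statements merged into one kernel-verified Lean document; each statement's English description precedes it below -/
import Mathlib

section
/- Every co-bipartite digraph D with arc-connectivity λ(D) ≥ 2 has a good pair. -/
/-!
Digraphs are modelled by a finite vertex type `V` (with decidable equality) together with
an arc set `A : Finset (V × V)`; irreflexivity (`∀ e ∈ A, e.1 ≠ e.2`) is stated as a
hypothesis.  Subdigraphs on a vertex set `S : Finset V` use arcs with both endpoints in `S`.
-/

variable {V : Type*} [Fintype V] [DecidableEq V]

/-- Reachability by a directed path using arcs of `B`. -/
def Reach (B : Finset (V × V)) : V → V → Prop :=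
  Relation.ReflTransGen (fun u v => (u, v) ∈ B)

/-- `B` is an out-branching, rooted at `q`, of the digraph with vertex set `S`
and arc set `A`: a spanning subdigraph in which every vertex is reachable from `q`
and every vertex other than `q` has in-degree exactly one. -/
def IsOutBranching (S : Finset V) (A B : Finset (V × V)) (q : V) : Prop :=
  q ∈ S ∧ B ⊆ A ∧ (∀ e ∈ B, e.1 ∈ S ∧ e.2 ∈ S) ∧
    (∀ v ∈ S, Reach B q v) ∧
    ∀ v ∈ S, v ≠ q → (B.filter (fun e => e.2 = v)).card = 1

/-- `B` is an in-branching, rooted at `r`, of the digraph with vertex set `S`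
and arc set `A`: a spanning subdigraph in which `r` is reachable from every vertex
and every vertex other than `r` has out-degree exactly one. -/
def IsInBranching (S : Finset V) (A B : Finset (V × V)) (r : V) : Prop :=
  r ∈ S ∧ B ⊆ A ∧ (∀ e ∈ B, e.1 ∈ S ∧ e.2 ∈ S) ∧
    (∀ v ∈ S, Reach B v r) ∧
    ∀ v ∈ S, v ≠ r → (B.filter (fun e => e.1 = v)).card = 1

/-- A good pair: an in-branching and an out-branching sharing no arc. -/
def GoodPair (S : Finset V) (A : Finset (V × V)) : Prop :=
  ∃ (I O : Finset (V × V)) (r q : V),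
    IsInBranching S A I r ∧ IsOutBranching S A O q ∧ Disjoint I O

/-- A good `r`-pair: a good pair whose in-branching is rooted at `r`. -/
def GoodRPair (S : Finset V) (A : Finset (V × V)) (r : V) : Prop :=
  ∃ (I O : Finset (V × V)) (q : V),
    IsInBranching S A I r ∧ IsOutBranching S A O q ∧ Disjoint I O

/-- A good `(r,q)`-pair: in-branching rooted at `r`, out-branching rooted at `q`. -/
def GoodRQPair (S : Finset V) (A : Finset (V × V)) (r q : V) : Prop :=
  ∃ I O : Finset (V × V),
    IsInBranching S A I r ∧ IsOutBranching S A O q ∧ Disjoint I O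

/-- Number of arcs with tail in `X` and head outside `X`. -/
def cutCard (A : Finset (V × V)) (X : Finset V) : ℕ :=
  (A.filter (fun e => e.1 ∈ X ∧ e.2 ∉ X)).card

/-- Arc-connectivity is at least `k`. -/
def ArcConnAtLeast (A : Finset (V × V)) (k : ℕ) : Prop :=
  ∀ X : Finset V, X.Nonempty → X ≠ Finset.univ → k ≤ cutCard A X

/-- Arc-connectivity equals `k`. -/
def ArcConnEq (A : Finset (V × V)) (k : ℕ) : Prop :=
  ArcConnAtLeast A k ∧ ∃ X : Finset V, X.Nonempty ∧ X ≠ Finset.univ ∧ cutCard A X = k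

/-- `S` is an independent set: no two of its vertices are joined by an arc. -/
def IsIndep (A : Finset (V × V)) (S : Finset V) : Prop :=
  ∀ u ∈ S, ∀ v ∈ S, u ≠ v → (u, v) ∉ A ∧ (v, u) ∉ A

/-- The independence number is at most `k`. -/
def IndepNumLE (A : Finset (V × V)) (k : ℕ) : Prop :=
  ∀ S : Finset V, IsIndep A S → S.card ≤ k

/-- The independence number equals `k`. -/
def IndepNumEq (A : Finset (V × V)) (k : ℕ) : Prop :=
  IndepNumLE A k ∧ ∃ S : Finset V, IsIndep A S ∧ S.card = k

/-- The subdigraph induced on `S` is semicomplete. -/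
def SemicompleteOn (S : Finset V) (A : Finset (V × V)) : Prop :=
  ∀ u ∈ S, ∀ v ∈ S, u ≠ v → (u, v) ∈ A ∨ (v, u) ∈ A

/-- The digraph is co-bipartite. -/
def CoBipartite (A : Finset (V × V)) : Prop :=
  ∃ S : Finset V, SemicompleteOn S A ∧ SemicompleteOn Sᶜ A

/-- In-degree of a vertex. -/
def inDeg (A : Finset (V × V)) (v : V) : ℕ := (A.filter (fun e => e.2 = v)).card

/-- Out-degree of a vertex. -/
def outDeg (A : Finset (V × V)) (v : V) : ℕ := (A.filter (fun e => e.1 = v)).card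

/-- Minimum semidegree is at least `k`. -/
def MinSemidegreeGE (A : Finset (V × V)) (k : ℕ) : Prop :=
  ∀ v : V, k ≤ inDeg A v ∧ k ≤ outDeg A v

/-- Reachability by a directed path whose vertices all lie in `T`, using arcs of `A`. -/
def ReachInSet (T : Set V) (A : Finset (V × V)) : V → V → Prop :=
  Relation.ReflTransGen (fun a b => (a, b) ∈ A ∧ a ∈ T ∧ b ∈ T)

open Relation (ReflTransGen)

section Split

variable {α : Type*} {E : α → α → Prop} {S T Z : Set α} {r q : α}

/-- The digraph induced by `E` on `S` contains two arc-disjoint subdigraphs, one in which every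
vertex of `S` reaches `r` and one in which every vertex of `S` is reached from `q`. -/
def HasSplit (E : α → α → Prop) (S : Set α) (r q : α) : Prop :=
  r ∈ S ∧ q ∈ S ∧ ∃ I O : α → α → Prop,
    (∀ u v, I u v → E u v ∧ u ∈ S ∧ v ∈ S) ∧ (∀ u v, O u v → E u v ∧ u ∈ S ∧ v ∈ S) ∧
    (∀ u v, I u v → ¬ O u v) ∧
    (∀ v ∈ S, ReflTransGen I v r) ∧ ∀ v ∈ S, ReflTransGen O q v

/-- Any two distinct vertices of `T` are joined by an arc. -/
def SemiOn (E : α → α → Prop) (T : Set α) : Prop :=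
  ∀ u ∈ T, ∀ v ∈ T, u ≠ v → E u v ∨ E v u

/-- Every nonempty proper subset of `T` is left by an arc inside `T`. -/
def StrongOn (E : α → α → Prop) (T : Set α) : Prop :=
  ∀ U ⊆ T, U.Nonempty → U ≠ T → ∃ u ∈ U, ∃ v ∈ T, v ∉ U ∧ E u v

/-- The arcs from `U` to `W`. -/
def arcsBetween (E : α → α → Prop) (U W : Set α) : Set (α × α) :=
  {e | E e.1 e.2 ∧ e.1 ∈ U ∧ e.2 ∈ W}

/-- Every nonempty proper subset is left by at least two arcs. -/
def TwoArcStrong (E : α → α → Prop) : Prop :=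
  ∀ U : Set α, U.Nonempty → U ≠ Set.univ → 2 ≤ (arcsBetween E U Uᶜ).ncard

theorem SemiOn.swap (h : SemiOn E T) : SemiOn (Function.swap E) T :=
  fun u hu v hv huv => (h u hu v hv huv).symm

theorem SemiOn.mono (h : SemiOn E T) (hS : S ⊆ T) : SemiOn E S :=
  fun u hu v hv => h u (hS hu) v (hS hv)

theorem StrongOn.swap (h : StrongOn E T) : StrongOn (Function.swap E) T := by
  intro U hU hne hUT
  obtain ⟨u, ⟨hu, huU⟩, v, hv, hvU, huv⟩ := h (T \ U) Set.sdiff_subset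
    (by
      rw [Set.sdiff_nonempty]
      exact fun h' => hUT (hU.antisymm h'))
    (by
      intro h'
      obtain ⟨x, hx⟩ := hne
      exact (h'.symm ▸ hU hx : x ∈ T \ U).2 hx)
  exact ⟨v, by_contra fun h' => hvU ⟨hv, h'⟩, u, hu, huU, huv⟩

theorem ncard_arcsBetween_swap (U W : Set α) :
    (arcsBetween (Function.swap E) U W).ncard = (arcsBetween E W U).ncard := by
  refine Set.ncard_congr (fun e _ => e.swap) ?_ ?_ ?_
  · rintro ⟨a, b⟩ ⟨h, ha, hb⟩
    exact ⟨h, hb, ha⟩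
  · rintro ⟨a, b⟩ ⟨c, d⟩ - - h
    simpa [and_comm] using h
  · rintro ⟨a, b⟩ ⟨h, ha, hb⟩
    exact ⟨(b, a), ⟨h, hb, ha⟩, rfl⟩

theorem TwoArcStrong.swap (h : TwoArcStrong E) : TwoArcStrong (Function.swap E) := by
  intro U hne hU
  rw [ncard_arcsBetween_swap]
  have := h Uᶜ (Set.nonempty_compl.2 hU) (by simpa [Set.nonempty_iff_ne_empty] using hne)
  rwa [compl_compl] at this

theorem HasSplit.swap (h : HasSplit E S r q) : HasSplit (Function.swap E) S q r := by
  obtain ⟨hr, hq, I, O, hI, hO, hd, hIr, hOq⟩ := h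
  refine ⟨hq, hr, Function.swap O, Function.swap I, ?_, ?_, ?_, ?_, ?_⟩
  · exact fun u v h => ⟨(hO v u h).1, (hO v u h).2.2, (hO v u h).2.1⟩
  · exact fun u v h => ⟨(hI v u h).1, (hI v u h).2.2, (hI v u h).2.1⟩
  · exact fun u v h h' => hd v u h' h
  · exact fun v hv => Relation.reflTransGen_swap.2 (hOq v hv)
  · exact fun v hv => Relation.reflTransGen_swap.2 (hIr v hv)

theorem hasSplit_singleton (E : α → α → Prop) (v : α) : HasSplit E {v} v v := by
  refine ⟨rfl, rfl, fun _ _ => False, fun _ _ => False, by simp, by simp, by simp, ?_, ?_⟩ <;>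
    rintro _ rfl <;> exact .refl

theorem HasSplit.union (h : HasSplit E S r q) (hSZ : ∀ z ∈ Z, z ∉ S) {I' O' : α → α → Prop}
    (hI' : ∀ u v, I' u v → E u v ∧ u ∈ Z ∧ v ∈ S ∪ Z)
    (hO' : ∀ u v, O' u v → E u v ∧ u ∈ S ∪ Z ∧ v ∈ Z)
    (hd' : ∀ u v, I' u v → ¬ O' u v)
    (hI'r : ∀ z ∈ Z, ∃ s ∈ S, ReflTransGen I' z s)
    (hO'q : ∀ z ∈ Z, ∃ s ∈ S, ReflTransGen O' s z) : HasSplit E (S ∪ Z) r q := by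
  obtain ⟨hr, hq, I, O, hI, hO, hd, hIr, hOq⟩ := h
  refine ⟨.inl hr, .inl hq, fun u v => I u v ∨ I' u v, fun u v => O u v ∨ O' u v, ?_, ?_, ?_,
    ?_, ?_⟩
  · rintro u v (h | h)
    · exact ⟨(hI u v h).1, .inl (hI u v h).2.1, .inl (hI u v h).2.2⟩
    · exact ⟨(hI' u v h).1, .inr (hI' u v h).2.1, (hI' u v h).2.2⟩
  · rintro u v (h | h)
    · exact ⟨(hO u v h).1, .inl (hO u v h).2.1, .inl (hO u v h).2.2⟩
    · exact ⟨(hO' u v h).1, (hO' u v h).2.1, .inr (hO' u v h).2.2⟩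
  · rintro u v (h | h) (h' | h')
    · exact hd u v h h'
    · exact hSZ v (hO' u v h').2.2 (hI u v h).2.2
    · exact hSZ u (hI' u v h).2.1 (hO u v h').2.1
    · exact hd' u v h h'
  · rintro v (hv | hv)
    · exact ReflTransGen.mono (fun _ _ h => .inl h) _ _ (hIr v hv)
    · obtain ⟨s, hs, h⟩ := hI'r v hv
      exact (ReflTransGen.mono (fun _ _ h => .inr h) _ _ h).trans
        (ReflTransGen.mono (fun _ _ h => .inl h) _ _ (hIr s hs))
  · rintro v (hv | hv)
    · exact ReflTransGen.mono (fun _ _ h => .inl h) _ _ (hOq v hv)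
    · obtain ⟨s, hs, h⟩ := hO'q v hv
      exact (ReflTransGen.mono (fun _ _ h => .inl h) _ _ (hOq s hs)).trans
        (ReflTransGen.mono (fun _ _ h => .inr h) _ _ h)

theorem HasSplit.insert_of_arcs (h : HasSplit E S r q) {u v w : α} (hv : v ∉ S) (hu : u ∈ S)
    (hw : w ∈ S) (huv : E u v) (hvw : E v w) : HasSplit E (insert v S) r q := by
  rw [Set.insert_eq, Set.union_comm]
  refine h.union (I' := fun a b => a = v ∧ b = w) (O' := fun a b => a = u ∧ b = v)
    ?_ ?_ ?_ ?_ ?_ ?_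
  · rintro z rfl
    exact hv
  · rintro _ _ ⟨rfl, rfl⟩
    exact ⟨hvw, rfl, .inl hw⟩
  · rintro _ _ ⟨rfl, rfl⟩
    exact ⟨huv, .inl hu, rfl⟩
  · rintro _ _ ⟨rfl, rfl⟩ ⟨rfl, -⟩
    exact hv hu
  · rintro z rfl
    exact ⟨w, hw, .single ⟨rfl, rfl⟩⟩
  · rintro z rfl
    exact ⟨u, hu, .single ⟨rfl, rfl⟩⟩

theorem HasSplit.join {S₁ S₂ : Set α} {r₁ q₁ r₂ q₂ a b : α} (h₁ : HasSplit E S₁ r₁ q₁)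
    (h₂ : HasSplit E S₂ r₂ q₂) (hd : ∀ v ∈ S₁, v ∉ S₂) (hb : b ∈ S₂) (ha : a ∈ S₁)
    (hrb : E r₁ b) (haq : E a q₂) (hne : ¬ (r₁ = a ∧ b = q₂)) :
    HasSplit E (S₁ ∪ S₂) r₂ q₁ := by
  obtain ⟨hr₁, hq₁, I₁, O₁, hI₁, hO₁, hd₁, hIr₁, hOq₁⟩ := h₁
  obtain ⟨hr₂, hq₂, I₂, O₂, hI₂, hO₂, hd₂, hIr₂, hOq₂⟩ := h₂
  refine ⟨.inr hr₂, .inl hq₁, fun u v => I₁ u v ∨ I₂ u v ∨ (u = r₁ ∧ v = b),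
    fun u v => O₁ u v ∨ O₂ u v ∨ (u = a ∧ v = q₂), ?_, ?_, ?_, ?_, ?_⟩
  · rintro u v (h | h | ⟨rfl, rfl⟩)
    · exact ⟨(hI₁ u v h).1, .inl (hI₁ u v h).2.1, .inl (hI₁ u v h).2.2⟩
    · exact ⟨(hI₂ u v h).1, .inr (hI₂ u v h).2.1, .inr (hI₂ u v h).2.2⟩
    · exact ⟨hrb, .inl hr₁, .inr hb⟩
  · rintro u v (h | h | ⟨rfl, rfl⟩)
    · exact ⟨(hO₁ u v h).1, .inl (hO₁ u v h).2.1, .inl (hO₁ u v h).2.2⟩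
    · exact ⟨(hO₂ u v h).1, .inr (hO₂ u v h).2.1, .inr (hO₂ u v h).2.2⟩
    · exact ⟨haq, .inl ha, .inr hq₂⟩
  · rintro u v (h | h | ⟨rfl, rfl⟩) (h' | h' | ⟨h'₁, h'₂⟩)
    · exact hd₁ u v h h'
    · exact hd u (hI₁ u v h).2.1 (hO₂ u v h').2.1
    · exact hd v (hI₁ u v h).2.2 (h'₂ ▸ hq₂)
    · exact hd u (hO₁ u v h').2.1 (hI₂ u v h).2.1
    · exact hd₂ u v h h'
    · exact hd a ha (h'₁ ▸ (hI₂ u v h).2.1)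
    · exact hd _ (hO₁ _ _ h').2.2 hb
    · exact hd _ hr₁ (hO₂ _ _ h').2.1
    · exact hne ⟨h'₁, h'₂⟩
  · have key : ∀ v ∈ S₂, ReflTransGen (fun u v => I₁ u v ∨ I₂ u v ∨ (u = r₁ ∧ v = b)) v r₂ :=
      fun v hv => ReflTransGen.mono (fun _ _ h => .inr (.inl h)) _ _ (hIr₂ v hv)
    rintro v (hv | hv)
    · have h1 : ReflTransGen (fun u v => I₁ u v ∨ I₂ u v ∨ (u = r₁ ∧ v = b)) v r₁ :=
        ReflTransGen.mono (fun _ _ h => .inl h) _ _ (hIr₁ v hv)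
      exact (h1.tail (.inr (.inr ⟨rfl, rfl⟩))).trans (key b hb)
    · exact key v hv
  · have key : ∀ v ∈ S₁, ReflTransGen (fun u v => O₁ u v ∨ O₂ u v ∨ (u = a ∧ v = q₂)) q₁ v :=
      fun v hv => ReflTransGen.mono (fun _ _ h => .inl h) _ _ (hOq₁ v hv)
    rintro v (hv | hv)
    · exact key v hv
    · have h1 : ReflTransGen (fun u v => O₁ u v ∨ O₂ u v ∨ (u = a ∧ v = q₂)) q₂ v :=
        ReflTransGen.mono (fun _ _ h => .inr (.inl h)) _ _ (hOq₂ v hv)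
      exact ((key a ha).tail (.inr (.inr ⟨rfl, rfl⟩))).trans h1

theorem HasSplit.insert_keep_source (h : HasSplit E S r q) (hS : S.Nontrivial) {u w : α}
    (hw : w ∉ S) (hadj : ∀ s ∈ S, E s w ∨ E w s) (hu : u ∈ S) (huw : E u w) :
    ∃ r', HasSplit E (insert w S) r' q := by
  by_cases hy : ∃ y ∈ S, E w y
  · obtain ⟨y, hy, hwy⟩ := hy
    exact ⟨r, h.insert_of_arcs hw hu hy huw hwy⟩
  · have hall : ∀ s ∈ S, E s w := fun s hs => (hadj s hs).resolve_right fun h' => hy ⟨s, hs, h'⟩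
    obtain ⟨a, ha, har⟩ := hS.exists_ne r
    have := h.join (hasSplit_singleton E w) (a := a) (b := w) (fun v hv h' => hw (h' ▸ hv)) rfl ha
      (hall r h.1) (hall a ha) fun h' => har h'.1.symm
    rw [Set.union_comm, ← Set.insert_eq] at this
    exact ⟨w, this⟩

theorem HasSplit.insert_of_adj (h : HasSplit E S r q) (hS : S.Nontrivial) {w : α}
    (hw : w ∉ S) (hadj : ∀ s ∈ S, E s w ∨ E w s) : ∃ r' q', HasSplit E (insert w S) r' q' := by
  by_cases hy : ∃ y ∈ S, E y w
  · obtain ⟨y, hy, hyw⟩ := hy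
    obtain ⟨r', h'⟩ := h.insert_keep_source hS hw hadj hy hyw
    exact ⟨r', q, h'⟩
  · obtain ⟨s, hs⟩ := hS.nonempty
    have hws : E w s := (hadj s hs).resolve_left fun h' => hy ⟨s, hs, h'⟩
    obtain ⟨q', h'⟩ := h.swap.insert_keep_source hS hw (fun s hs => (hadj s hs).symm) hs hws
    exact ⟨r, q', h'.swap⟩

theorem HasSplit.exists_of_subset [Finite α] (h : HasSplit E S r q) (hS : S.Nontrivial)
    (hST : S ⊆ T) (hT : SemiOn E T) : ∃ r' q', HasSplit E T r' q' := by
  induction S using WellFoundedGT.induction generalizing r q with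
  | _ S ih =>
  by_cases hTS : T ⊆ S
  · exact ⟨r, q, hST.antisymm hTS ▸ h⟩
  · obtain ⟨w, hwT, hw⟩ := Set.not_subset.1 hTS
    obtain ⟨r', q', h'⟩ := h.insert_of_adj hS hw
      fun s hs => hT s (hST hs) w hwT fun e => hw (e ▸ hs)
    exact ih _ (Set.ssubset_insert hw) h' (hS.mono (Set.subset_insert _ _))
      (Set.insert_subset hwT hST)

theorem HasSplit.exists_of_subset_of_strongOn [Finite α] (h : HasSplit E S r q)
    (hS : S.Nontrivial) (hST : S ⊆ T) (hT : SemiOn E T) (hstr : StrongOn E T) :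
    ∃ r', HasSplit E T r' q := by
  induction S using WellFoundedGT.induction generalizing r with
  | _ S ih =>
  by_cases hTS : S = T
  · exact ⟨r, hTS ▸ h⟩
  · obtain ⟨u, hu, w, hwT, hw, huw⟩ := hstr S hST hS.nonempty hTS
    obtain ⟨r', h'⟩ := h.insert_keep_source hS hw
      (fun s hs => hT s (hST hs) w hwT fun e => hw (e ▸ hs)) hu huw
    exact ih _ (Set.ssubset_insert hw) h' (hS.mono (Set.subset_insert _ _))
      (Set.insert_subset hwT hST)

theorem hasSplit_of_trees {y₁ y₂ y₃ z₂ z₃ w₁ w₂ w₃ t₂ t₃ : α} (hS : S = {r, y₁, y₂, y₃})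
    (hS' : S = {q, w₁, w₂, w₃}) (hy₁ : E y₁ r) (hy₂ : E y₂ z₂) (hy₃ : E y₃ z₃)
    (hw₁ : E q w₁) (hw₂ : E t₂ w₂) (hw₃ : E t₃ w₃) (hz₂ : z₂ = r ∨ z₂ = y₁)
    (hz₃ : z₃ = r ∨ z₃ = y₁ ∨ z₃ = y₂) (ht₂ : t₂ = q ∨ t₂ = w₁)
    (ht₃ : t₃ = q ∨ t₃ = w₁ ∨ t₃ = w₂)
    (hd : ∀ u v, u = y₁ ∧ v = r ∨ u = y₂ ∧ v = z₂ ∨ u = y₃ ∧ v = z₃ →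
      ¬ (u = q ∧ v = w₁ ∨ u = t₂ ∧ v = w₂ ∨ u = t₃ ∧ v = w₃)) : HasSplit E S r q := by
  refine ⟨by simp [hS], by simp [hS'],
    fun u v => u = y₁ ∧ v = r ∨ u = y₂ ∧ v = z₂ ∨ u = y₃ ∧ v = z₃,
    fun u v => u = q ∧ v = w₁ ∨ u = t₂ ∧ v = w₂ ∨ u = t₃ ∧ v = w₃, ?_, ?_, hd, ?_, ?_⟩
  · rintro u v (⟨rfl, rfl⟩ | ⟨rfl, rfl⟩ | ⟨rfl, rfl⟩)
    · exact ⟨hy₁, by simp [hS], by simp [hS]⟩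
    · exact ⟨hy₂, by simp [hS], by rcases hz₂ with rfl | rfl <;> simp [hS]⟩
    · exact ⟨hy₃, by simp [hS], by rcases hz₃ with rfl | rfl | rfl <;> simp [hS]⟩
  · rintro u v (⟨rfl, rfl⟩ | ⟨rfl, rfl⟩ | ⟨rfl, rfl⟩)
    · exact ⟨hw₁, by simp [hS'], by simp [hS']⟩
    · exact ⟨hw₂, by rcases ht₂ with rfl | rfl <;> simp [hS'], by simp [hS']⟩
    · exact ⟨hw₃, by rcases ht₃ with rfl | rfl | rfl <;> simp [hS'], by simp [hS']⟩
  · clear hd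
    set I : α → α → Prop := fun u v => u = y₁ ∧ v = r ∨ u = y₂ ∧ v = z₂ ∨ u = y₃ ∧ v = z₃
    have h1 : ReflTransGen I y₁ r := .single (.inl ⟨rfl, rfl⟩)
    have h2 : ReflTransGen I y₂ r :=
      .head (.inr (.inl ⟨rfl, rfl⟩)) (by rcases hz₂ with rfl | rfl; exacts [.refl, h1])
    have h3 : ReflTransGen I y₃ r :=
      .head (.inr (.inr ⟨rfl, rfl⟩)) (by rcases hz₃ with rfl | rfl | rfl; exacts [.refl, h1, h2])
    rw [hS]
    rintro v (rfl | rfl | rfl | rfl)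
    exacts [.refl, h1, h2, h3]
  · clear hd
    set O : α → α → Prop := fun u v => u = q ∧ v = w₁ ∨ u = t₂ ∧ v = w₂ ∨ u = t₃ ∧ v = w₃
    have h1 : ReflTransGen O q w₁ := .single (.inl ⟨rfl, rfl⟩)
    have h2 : ReflTransGen O q w₂ :=
      .tail (by rcases ht₂ with rfl | rfl; exacts [.refl, h1]) (.inr (.inl ⟨rfl, rfl⟩))
    have h3 : ReflTransGen O q w₃ :=
      .tail (by rcases ht₃ with rfl | rfl | rfl; exacts [.refl, h1, h2]) (.inr (.inr ⟨rfl, rfl⟩))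
    rw [hS']
    rintro v (rfl | rfl | rfl | rfl)
    exacts [.refl, h1, h2, h3]

theorem hasSplit_of_transitive {a b c : α} (hS : S = {q, a, b, c}) (hqab : [q, a, b, c].Nodup)
    (qa : E q a) (qb : E q b) (qc : E q c) (ab : E a b) (bc : E b c) (ac : E a c) :
    HasSplit E S c q := by
  refine hasSplit_of_trees (y₁ := b) (y₂ := a) (z₂ := b) (y₃ := q) (z₃ := c) (w₁ := a) (w₂ := b)
    (t₂ := q) (w₃ := c) (t₃ := a) ?_ hS bc ab qc qa qb ac (by simp) (by simp) (by simp) (by simp) ?_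
  · rw [hS]; ext; simp; tauto
  · simp at hqab; grind

theorem hasSplit_of_source_cycle {a b c : α} (hS : S = {q, a, b, c}) (hqab : [q, a, b, c].Nodup)
    (qa : E q a) (qb : E q b) (qc : E q c) (ab : E a b) (bc : E b c) (ca : E c a) :
    HasSplit E S a q := by
  refine hasSplit_of_trees (y₁ := c) (y₂ := b) (z₂ := c) (y₃ := q) (z₃ := b) (w₁ := a) (w₂ := b)
    (t₂ := a) (w₃ := c) (t₃ := q) ?_ hS ca bc qb qa ab qc (by simp) (by simp) (by simp) (by simp) ?_
  · rw [hS]; ext; simp; tauto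
  · simp at hqab; grind

theorem exists_hasSplit_of_source {a b c : α} (hS : S = {q, a, b, c})
    (hqab : [q, a, b, c].Nodup) (qa : E q a) (qb : E q b) (qc : E q c) (ab : E a b ∨ E b a)
    (bc : E b c ∨ E c b) (ac : E a c ∨ E c a) : ∃ r, HasSplit E S r q := by
  wlog h : E a b generalizing a b
  · refine this (a := b) (b := a) ?_ ?_ qb qa ab.symm ac bc (ab.resolve_left h)
    · rw [hS]; ext; simp; tauto
    · simp at hqab ⊢; grind
  rcases bc with bc | cb <;> rcases ac with ac | ca
  · exact ⟨_, hasSplit_of_transitive hS hqab qa qb qc h bc ac⟩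
  · exact ⟨_, hasSplit_of_source_cycle hS hqab qa qb qc h bc ca⟩
  · refine ⟨_, hasSplit_of_transitive (a := a) (b := c) (c := b) ?_ ?_ qa qc qb ac cb h⟩
    · rw [hS]; ext; simp; tauto
    · simp at hqab ⊢; grind
  · refine ⟨_, hasSplit_of_transitive (a := c) (b := a) (c := b) ?_ ?_ qc qa qb ca h cb⟩
    · rw [hS]; ext; simp; tauto
    · simp at hqab ⊢; grind

theorem exists_hasSplit_of_back_arc {a b c : α} (hS : S = {q, a, b, c})
    (hqab : [q, a, b, c].Nodup) (qa : E q a) (qb : E q b) (ab : E a b) (cq : E c q)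
    (bc : E b c ∨ E c b) (ac : E a c ∨ E c a) (hc : E b c ∨ E a c) : ∃ r, HasSplit E S r q := by
  rcases bc with bc | cb
  · rcases ac with ac | ca
    · refine ⟨b, hasSplit_of_trees (y₁ := q) (y₂ := c) (z₂ := q) (y₃ := a) (z₃ := c) (w₁ := a)
        (w₂ := b) (t₂ := a) (w₃ := c) (t₃ := b) ?_ hS qb cq ac qa ab bc (by simp) (by simp)
        (by simp) (by simp) ?_⟩
      · rw [hS]; ext; simp; tauto
      · simp at hqab; grind
    · refine ⟨b, hasSplit_of_trees (y₁ := a) (y₂ := q) (z₂ := a) (y₃ := c) (z₃ := q) (w₁ := b)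
        (w₂ := c) (t₂ := b) (w₃ := a) (t₃ := c) ?_ ?_ ab qa cq qb bc ca (by simp) (by simp)
        (by simp) (by simp) ?_⟩
      · rw [hS]; ext; simp; tauto
      · rw [hS]; ext; simp; tauto
      · simp at hqab; grind
  · by_cases ac' : E a c
    · refine ⟨b, hasSplit_of_trees (y₁ := a) (y₂ := q) (z₂ := b) (y₃ := c) (z₃ := q) (w₁ := a)
        (w₂ := c) (t₂ := a) (w₃ := b) (t₃ := c) ?_ ?_ ab qb cq qa ac' cb (by simp) (by simp)
        (by simp) (by simp) ?_⟩
      · rw [hS]; ext; simp; tauto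
      · rw [hS]; ext; simp; tauto
      · simp at hqab; grind
    · have ca := ac.resolve_left ac'
      have bc := hc.resolve_right ac'
      refine ⟨b, hasSplit_of_trees (y₁ := a) (y₂ := q) (z₂ := a) (y₃ := c) (z₃ := q) (w₁ := b)
        (w₂ := c) (t₂ := b) (w₃ := a) (t₃ := c) ?_ ?_ ab qa cq qb bc ca (by simp) (by simp)
        (by simp) (by simp) ?_⟩
      · rw [hS]; ext; simp; tauto
      · rw [hS]; ext; simp; tauto
      · simp at hqab; grind

theorem StrongOn.exists_hasSplit [Finite α] (hstr : StrongOn E T) (hT : SemiOn E T)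
    {a b c : α} (hq : q ∈ T) (ha : a ∈ T) (hb : b ∈ T) (hc : c ∈ T)
    (hqab : [q, a, b, c].Nodup) (qa : E q a) (qb : E q b) : ∃ r, HasSplit E T r q := by
  have hqab' := hqab
  simp only [List.nodup_cons, List.mem_cons, List.not_mem_nil, or_false, not_or, not_false_eq_true,
    List.nodup_nil, and_true] at hqab'
  obtain ⟨⟨nqa, nqb, nqc⟩, ⟨nab, nac⟩, nbc⟩ := hqab'
  wlog ab : E a b generalizing a b
  · refine this hb ha ?_ qb qa nqb nqa nac (Ne.symm nab) nbc
      ((hT a ha b hb nab).resolve_left ab)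
    simp at hqab ⊢; grind
  by_cases h2 : ∃ x ∈ T, x ≠ q ∧ E q x ∧ E x q
  · obtain ⟨x, hx, hxq, qx, xq⟩ := h2
    refine ((hasSplit_singleton E q).insert_of_arcs (v := x) hxq rfl rfl qx xq
      ).exists_of_subset_of_strongOn (Set.nontrivial_pair hxq) ?_ hT hstr
    rintro _ (rfl | rfl) <;> assumption
  push Not at h2
  by_cases ba : E b a
  · have h3 := (hasSplit_singleton E q).join (a := q) (b := b)
      ((hasSplit_singleton E a).insert_of_arcs (v := b) (Ne.symm nab) rfl rfl ab ba)
      (by rintro _ rfl; simp [nqa, nqb]) (by simp) rfl qb qa (fun h => nab h.2.symm)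
    refine h3.exists_of_subset_of_strongOn ⟨q, by simp, a, by simp, nqa⟩ ?_ hT hstr
    rintro x (rfl | rfl | rfl) <;> assumption
  have finish : ∀ c ∈ T, (∃ r, HasSplit E {q, a, b, c} r q) → ∃ r, HasSplit E T r q := by
    rintro c hc ⟨r, h⟩
    refine h.exists_of_subset_of_strongOn ⟨q, by simp, a, by simp, nqa⟩ ?_ hT hstr
    rintro x (rfl | rfl | rfl | rfl) <;> assumption
  by_cases h3 : ∃ c ∈ T, c ≠ q ∧ c ≠ a ∧ c ≠ b ∧ E q c
  · obtain ⟨c, hc, cq, ca, cb, qc⟩ := h3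
    refine finish c hc (exists_hasSplit_of_source rfl ?_ qa qb qc (.inl ab)
      (hT b hb c hc cb.symm) (hT a ha c hc ca.symm))
    simp; grind
  push Not at h3
  obtain ⟨u, hu, v, hv, hvU, huv⟩ := hstr {q, a, b} (by rintro x (rfl | rfl | rfl) <;> assumption)
    ⟨q, by simp⟩ (fun h => by have := h ▸ hc; simp at this; grind)
  simp only [Set.mem_insert_iff, Set.mem_singleton_iff, not_or] at hvU
  have nqv := h3 v hv hvU.1 hvU.2.1 hvU.2.2
  refine finish v hv (exists_hasSplit_of_back_arc rfl ?_ qa qb ab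
    ((hT q hq v hv (Ne.symm hvU.1)).resolve_left nqv) (hT b hb v hv (Ne.symm hvU.2.2))
    (hT a ha v hv (Ne.symm hvU.2.1)) ?_)
  · simp; grind
  · rcases hu with rfl | rfl | rfl
    exacts [absurd huv nqv, .inr huv, .inl huv]

theorem SemiOn.exists_hasSplit_of_arcs [Finite α] (hT : SemiOn E T) {a b c : α} (hq : q ∈ T)
    (ha : a ∈ T) (hb : b ∈ T) (hc : c ∈ T) (hqab : [q, a, b, c].Nodup) (qa : E q a)
    (qb : E q b) : ∃ r q', HasSplit E T r q' := by
  have hqab' := hqab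
  simp only [List.nodup_cons, List.mem_cons, List.not_mem_nil, or_false, not_or, not_false_eq_true,
    List.nodup_nil, and_true] at hqab'
  obtain ⟨⟨nqa, nqb, nqc⟩, ⟨nab, nac⟩, nbc⟩ := hqab'
  wlog ab : E a b generalizing a b
  · refine this hb ha ?_ qb qa nqb nqa nac (Ne.symm nab) nbc
      ((hT a ha b hb nab).resolve_left ab)
    simp at hqab ⊢; grind
  have hST : ({q, a, b, c} : Set α) ⊆ T := by rintro x (rfl | rfl | rfl | rfl) <;> assumption
  have finish : (∃ r q', HasSplit E {q, a, b, c} r q') → ∃ r q', HasSplit E T r q' := by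
    rintro ⟨r, q', h⟩
    exact h.exists_of_subset ⟨q, by simp, a, by simp, nqa⟩ hST hT
  have hbc := hT b hb c hc nbc
  have hac := hT a ha c hc nac
  rcases hT q hq c hc nqc with qc | cq
  · obtain ⟨r, h⟩ := exists_hasSplit_of_source rfl hqab qa qb qc (.inl ab) hbc hac
    exact finish ⟨r, q, h⟩
  · by_cases h : E b c ∨ E a c
    · obtain ⟨r, h⟩ := exists_hasSplit_of_back_arc rfl hqab qa qb ab cq hbc hac h
      exact finish ⟨r, q, h⟩
    · push Not at h
      refine finish ⟨b, c, hasSplit_of_transitive (a := q) (b := a) (c := b) ?_ ?_ cq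
        (hac.resolve_left h.2) (hbc.resolve_left h.1) qa ab qb⟩
      · ext; simp; tauto
      · simp at hqab ⊢; grind

theorem SemiOn.exists_hasSplit [Finite α] (hT : SemiOn E T) (hcard : 4 ≤ T.ncard) :
    ∃ r q, HasSplit E T r q := by
  have hfin := T.toFinite
  rw [Set.ncard_eq_toFinset_card T hfin] at hcard
  obtain ⟨a, ha, b, hb, c, hc, d, hd, ab, ac, ad, bc, bd, cd⟩ := Finset.three_lt_card.1 hcard
  rw [Set.Finite.mem_toFinset] at ha hb hc hd
  have key : ∀ x ∈ T, ∀ y ∈ T, ∀ z ∈ T, ∀ w ∈ T, [x, y, z, w].Nodup → E x y → E x z →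
      ∃ r q, HasSplit E T r q := fun x hx y hy z hz w hw hn hxy hxz =>
    hT.exists_hasSplit_of_arcs hx hy hz hw hn hxy hxz
  simp only [List.nodup_cons, List.mem_cons, List.not_mem_nil, or_false, not_or, not_false_eq_true,
    List.nodup_nil, and_true] at key
  have hab := hT a ha b hb ab
  have hac := hT a ha c hc ac
  have had := hT a ha d hd ad
  have hbc := hT b hb c hc bc
  have hbd := hT b hb d hd bd
  have hcd := hT c hc d hd cd
  by_contra hno
  grind

theorem exists_injective_of_card_le {ι β : Type*} (t : ι → Finset β) (h₁ : ∀ i, 1 ≤ (t i).card)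
    (h₃ : ∀ i j, i ≠ j → 3 ≤ (t i).card + (t j).card)
    (h₂ : ∀ e i j k, e ∈ t i → e ∈ t j → e ∈ t k → i = j ∨ i = k ∨ j = k) :
    ∃ f : ι → β, Function.Injective f ∧ ∀ i, f i ∈ t i := by
  classical
  rw [← Finset.all_card_le_biUnion_card_iff_exists_injective]
  intro s
  have hsum : ∑ i ∈ s, (t i).card ≤ 2 * (s.biUnion t).card := by
    have h := Finset.sum_card_bipartiteAbove_eq_sum_card_bipartiteBelow
      (fun i e => e ∈ t i) (s := s) (t := s.biUnion t)
    have h' : ∑ i ∈ s, (t i).card =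
        ∑ i ∈ s, ((s.biUnion t).bipartiteAbove (fun i e => e ∈ t i) i).card := by
      refine Finset.sum_congr rfl fun i hi => congrArg _ ?_
      ext e
      simp only [Finset.mem_bipartiteAbove, Finset.mem_biUnion]
      exact ⟨fun h => ⟨⟨i, hi, h⟩, h⟩, fun h => h.2⟩
    rw [h', h, mul_comm, ← smul_eq_mul]
    refine Finset.sum_le_card_nsmul _ _ _ fun e _ => ?_
    by_contra! hlt
    obtain ⟨i, hi, j, hj, k, hk, hij, hik, hjk⟩ := Finset.two_lt_card.1 hlt
    simp only [Finset.mem_bipartiteBelow] at hi hj hk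
    rcases h₂ e i j k hi.2 hj.2 hk.2 with h | h | h
    exacts [hij h, hik h, hjk h]
  have hlow : 2 * s.card ≤ ∑ i ∈ s, (t i).card + 1 := by
    by_cases hall : ∀ i ∈ s, 2 ≤ (t i).card
    · have := Finset.card_nsmul_le_sum s _ 2 hall
      rw [smul_eq_mul] at this
      omega
    · push Not at hall
      obtain ⟨i, hi, hlt⟩ := hall
      have h := Finset.card_nsmul_le_sum (s.erase i) (fun i => (t i).card) 2 fun j hj => by
        have := h₃ i j (Finset.ne_of_mem_erase hj).symm
        omega
      rw [smul_eq_mul, Finset.card_erase_of_mem hi] at h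
      have h' := Finset.sum_erase_add s (fun i => (t i).card) hi
      have := h₁ i
      have := Finset.card_pos.2 ⟨i, hi⟩
      omega
  omega

/-- `U` is a nonempty subset of `Y` which no step of `R` between vertices of `Y` leaves. -/
def ClosedIn (R : α → α → Prop) (Y U : Set α) : Prop :=
  U ⊆ Y ∧ U.Nonempty ∧ ∀ u ∈ U, ∀ v ∈ Y, R u v → v ∈ U

theorem ClosedIn.eq_of_minimal {R : α → α → Prop} {Y U U' : Set α}
    (hU : Minimal (ClosedIn R Y) U) (hU' : Minimal (ClosedIn R Y) U') {x : α} (hx : x ∈ U)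
    (hx' : x ∈ U') : U = U' := by
  have h : ClosedIn R Y (U ∩ U') := ⟨fun y hy => hU.prop.1 hy.1, ⟨x, hx, hx'⟩,
    fun u hu v hv huv => ⟨hU.prop.2.2 u hu.1 v hv huv, hU'.prop.2.2 u hu.2 v hv huv⟩⟩
  exact Set.Subset.antisymm (fun y hy => (hU.le_of_le h Set.inter_subset_left hy).2)
    fun y hy => (hU'.le_of_le h Set.inter_subset_right hy).1

theorem ClosedIn.forall_reach [Finite α] {R I : α → α → Prop} {S Y : Set α}
    (hR : ∀ u ∈ Y, ∀ v ∈ Y, R u v → I u v)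
    (hmin : ∀ U, Minimal (ClosedIn R Y) U → ∃ u ∈ U, ∃ s ∈ S, ReflTransGen I u s) :
    ∀ y ∈ Y, ∃ s ∈ S, ReflTransGen I y s := by
  intro y hy
  by_contra hno
  obtain ⟨U, hU, hUm⟩ := exists_minimal_le_of_wellFoundedLT (ClosedIn R Y)
    {y ∈ Y | ¬ ∃ s ∈ S, ReflTransGen I y s}
    ⟨fun x hx => hx.1, ⟨y, hy, hno⟩, fun u hu v hv huv => ⟨hv, fun ⟨s, hs, h⟩ =>
      hu.2 ⟨s, hs, .head (hR u hu.1 v hv huv) h⟩⟩⟩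
  obtain ⟨u, hu, h⟩ := hmin U hUm
  exact (hU hu).2 h

theorem HasSplit.union_of_cuts [Finite α] {X Y : Set α} (h : HasSplit E S r q)
    (hYS : ∀ y ∈ Y, y ∉ S) (hXS : ∀ x ∈ X, x ∉ S) (hXY : ∀ x ∈ X, x ∉ Y)
    {B : α → α → Prop} (hB : ∀ u v, B u v → E u v ∧ u ∈ S ∪ Y ∧ v ∈ Y)
    (hB₁ : ∀ u v u' v', u ∈ Y → u' ∈ Y → B u v → B u' v' → u = u' ∧ v = v')
    (hBr : ∀ y ∈ Y, ∃ s ∈ S, ReflTransGen B s y) (hX : ∀ x ∈ X, ∃ s ∈ S, E x s)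
    (hcY : ∀ U ⊆ Y, U.Nonempty → 2 ≤ (arcsBetween E U ((S ∪ (Y ∪ X)) \ U)).ncard)
    (hcX : ∀ U ⊆ X, U.Nonempty → 2 ≤ (arcsBetween E ((S ∪ (Y ∪ X)) \ U) U).ncard) :
    HasSplit E (S ∪ (Y ∪ X)) r q := by
  classical
  have := Fintype.ofFinite α
  set RY : α → α → Prop := fun u v => E u v ∧ ¬ B u v with hRY
  set RX : α → α → Prop := Function.swap E with hRX
  let A₁ : Set α → Finset (α × α) := fun U => (arcsBetween E U (S ∪ X)).toFinset
  let A₂ : Set α → Finset (α × α) := fun U => (arcsBetween E (S ∪ Y) U).toFinset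
  have hA₁ : ∀ U e, e ∈ A₁ U ↔ E e.1 e.2 ∧ e.1 ∈ U ∧ e.2 ∈ S ∪ X := by
    exact fun U e => Set.mem_toFinset
  have hA₂ : ∀ U e, e ∈ A₂ U ↔ E e.1 e.2 ∧ e.1 ∈ S ∪ Y ∧ e.2 ∈ U := by
    exact fun U e => Set.mem_toFinset
  -- An arc leaving a closed set either leaves `Y` or belongs to `B`.
  have hleave : ∀ U, ClosedIn RY Y U → ∀ e ∈ arcsBetween E U ((S ∪ (Y ∪ X)) \ U),
      e ∈ A₁ U ∨ (B e.1 e.2 ∧ e.1 ∈ U) := by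
    rintro U ⟨hUY, -, hU⟩ ⟨u, v⟩ ⟨huv, hu, hv, hvU⟩
    rw [hA₁]
    rcases hv with hv | hv | hv
    · exact .inl ⟨huv, hu, .inl hv⟩
    · refine .inr ⟨by_contra fun h' => hvU (hU u hu v hv ⟨huv, h'⟩), hu⟩
    · exact .inl ⟨huv, hu, .inr hv⟩
  have hcard_of_not : ∀ U, ClosedIn RY Y U → (∀ u ∈ U, ∀ v, ¬ B u v) → 2 ≤ (A₁ U).card := by
    intro U hU hUB
    refine (hcY U hU.1 hU.2.1).trans ?_
    rw [← Set.ncard_coe_finset]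
    refine Set.ncard_le_ncard (fun e he => ?_) (Finset.finite_toSet _)
    exact (hleave U hU e he).resolve_right fun h' => hUB _ h'.2 _ h'.1
  have hcard_one : ∀ U, ClosedIn RY Y U → 1 ≤ (A₁ U).card := by
    intro U hU
    by_cases hUB : ∀ u ∈ U, ∀ v, ¬ B u v
    · exact (hcard_of_not U hU hUB).trans' one_le_two
    push Not at hUB
    obtain ⟨u, hu, v, huv⟩ := hUB
    have h2 := hcY U hU.1 hU.2.1
    have : arcsBetween E U ((S ∪ (Y ∪ X)) \ U) ⊆ ↑(insert (u, v) (A₁ U)) := by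
      intro e he
      rcases hleave U hU e he with h' | ⟨h', he⟩
      · simp [h']
      · obtain ⟨h₁, h₂⟩ := hB₁ e.1 e.2 u v (hU.1 he) (hU.1 hu) h' huv
        simp [Prod.ext_iff, h₁, h₂]
    have h3 := Set.ncard_le_ncard this (Finset.finite_toSet _)
    rw [Set.ncard_coe_finset] at h3
    have := Finset.card_insert_le (u, v) (A₁ U)
    omega
  have hcard_two : ∀ U, ClosedIn RX X U → 2 ≤ (A₂ U).card := by
    rintro U ⟨hUX, hUne, hU⟩
    refine (hcX U hUX hUne).trans ?_
    rw [← Set.ncard_coe_finset]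
    refine Set.ncard_le_ncard (fun e he => ?_) (Finset.finite_toSet _)
    obtain ⟨huv, ⟨hu, huU⟩, hv⟩ := he
    rw [Finset.mem_coe, hA₂]
    rcases hu with hu | hu | hu
    · exact ⟨huv, .inl hu, hv⟩
    · exact ⟨huv, .inr hu, hv⟩
    · exact absurd (hU _ hv _ hu huv) huU
  let ι := {U // Minimal (ClosedIn RY Y) U} ⊕ {U // Minimal (ClosedIn RX X) U}
  let t : ι → Finset (α × α) := Sum.elim (fun U => A₁ U) (fun U => A₂ U)
  have huniq₁ : ∀ U U' : {U // Minimal (ClosedIn RY Y) U}, ∀ x ∈ U.1, x ∈ U'.1 → U = U' :=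
    fun U U' x hx hx' => Subtype.ext (ClosedIn.eq_of_minimal U.2 U'.2 hx hx')
  have huniq₂ : ∀ U U' : {U // Minimal (ClosedIn RX X) U}, ∀ x ∈ U.1, x ∈ U'.1 → U = U' :=
    fun U U' x hx hx' => Subtype.ext (ClosedIn.eq_of_minimal U.2 U'.2 hx hx')
  obtain ⟨f, hf, hft⟩ := exists_injective_of_card_le t
    (by
      rintro (U | U)
      · exact hcard_one U U.2.prop
      · exact (hcard_two U U.2.prop).trans' one_le_two)
    (by
      rintro (U | U) (U' | U') hne
      · change 3 ≤ (A₁ U).card + (A₁ U').card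
        have h₁ := hcard_one U U.2.prop
        have h₁' := hcard_one U' U'.2.prop
        by_cases hUB : ∀ u ∈ U.1, ∀ v, ¬ B u v
        · have := hcard_of_not U U.2.prop hUB
          omega
        by_cases hUB' : ∀ u ∈ U'.1, ∀ v, ¬ B u v
        · have := hcard_of_not U' U'.2.prop hUB'
          omega
        push Not at hUB hUB'
        obtain ⟨u, hu, v, huv⟩ := hUB
        obtain ⟨u', hu', v', huv'⟩ := hUB'
        obtain ⟨rfl, -⟩ := hB₁ u v u' v' (U.2.prop.1 hu) (U'.2.prop.1 hu') huv huv'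
        exact absurd (congrArg Sum.inl (huniq₁ U U' u hu hu')) hne
      · have h₁ := hcard_one U U.2.prop
        have h₂ := hcard_two U' U'.2.prop
        change 3 ≤ (A₁ U).card + (A₂ U').card
        omega
      · have h₁ := hcard_two U U.2.prop
        have h₂ := hcard_one U' U'.2.prop
        change 3 ≤ (A₂ U).card + (A₁ U').card
        omega
      · have h₁ := hcard_two U U.2.prop
        have h₂ := hcard_two U' U'.2.prop
        change 3 ≤ (A₂ U).card + (A₂ U').card
        omega)
    (by
      have k₁ : ∀ e (U U' : {U // Minimal (ClosedIn RY Y) U}), e ∈ t (.inl U) → e ∈ t (.inl U') →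
          (.inl U : ι) = .inl U' := fun e U U' h h' =>
        congrArg _ (huniq₁ U U' e.1 ((hA₁ _ _).1 h).2.1 ((hA₁ _ _).1 h').2.1)
      have k₂ : ∀ e (U U' : {U // Minimal (ClosedIn RX X) U}), e ∈ t (.inr U) → e ∈ t (.inr U') →
          (.inr U : ι) = .inr U' := fun e U U' h h' =>
        congrArg _ (huniq₂ U U' e.2 ((hA₂ _ _).1 h).2.2 ((hA₂ _ _).1 h').2.2)
      rintro e (U | U) (U' | U') (U'' | U'') h h' h''
      · exact .inl (k₁ e _ _ h h')
      · exact .inl (k₁ e _ _ h h')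
      · exact .inr (.inl (k₁ e _ _ h h''))
      · exact .inr (.inr (k₂ e _ _ h' h''))
      · exact .inr (.inr (k₁ e _ _ h' h''))
      · exact .inr (.inl (k₂ e _ _ h h''))
      · exact .inl (k₂ e _ _ h h')
      · exact .inl (k₂ e _ _ h h'))
  have hf₁ : ∀ U, E (f (.inl U)).1 (f (.inl U)).2 ∧ (f (.inl U)).1 ∈ U.1 ∧
      (f (.inl U)).2 ∈ S ∪ X := fun U => (hA₁ _ _).1 (hft (.inl U))
  have hf₂ : ∀ U, E (f (.inr U)).1 (f (.inr U)).2 ∧ (f (.inr U)).1 ∈ S ∪ Y ∧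
      (f (.inr U)).2 ∈ U.1 := fun U => (hA₂ _ _).1 (hft (.inr U))
  have hYmem : ∀ U, (f (.inl U)).1 ∈ Y := fun U => U.2.prop.1 (hf₁ U).2.1
  have hXmem : ∀ U, (f (.inr U)).2 ∈ X := fun U => U.2.prop.1 (hf₂ U).2.2
  have hf₃ : ∀ U U', f (.inl U) ≠ f (.inr U') := fun U U' h' => by simpa using hf h'
  have hXI : ∀ x ∈ X, ∃ s ∈ S, ReflTransGen (fun u v => (u ∈ Y ∧ v ∈ Y ∧ RY u v) ∨
      (u ∈ X ∧ v ∈ S ∧ E u v) ∨ ∃ U, f (.inl U) = (u, v)) x s := by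
    intro x hx
    obtain ⟨s, hs, h'⟩ := hX x hx
    exact ⟨s, hs, .single (.inr (.inl ⟨hx, hs, h'⟩))⟩
  have hYO : ∀ y ∈ Y, ∃ s ∈ S, ReflTransGen (fun u v => (u ∈ X ∧ v ∈ X ∧ E u v) ∨ B u v ∨
      ∃ U, f (.inr U) = (u, v)) s y := by
    intro y hy
    obtain ⟨s, hs, h'⟩ := hBr y hy
    exact ⟨s, hs, ReflTransGen.mono (fun _ _ h => .inr (.inl h)) _ _ h'⟩
  refine h.union (I' := fun u v => (u ∈ Y ∧ v ∈ Y ∧ RY u v) ∨ (u ∈ X ∧ v ∈ S ∧ E u v) ∨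
      ∃ U, f (.inl U) = (u, v))
    (O' := fun u v => (u ∈ X ∧ v ∈ X ∧ E u v) ∨ B u v ∨ ∃ U, f (.inr U) = (u, v))
    ?_ ?_ ?_ ?_ ?_ ?_
  · rintro z (hz | hz)
    exacts [hYS z hz, hXS z hz]
  · rintro u v (⟨hu, hv, h'⟩ | ⟨hu, hv, h'⟩ | ⟨U, hU⟩)
    · exact ⟨h'.1, .inl hu, .inr (.inl hv)⟩
    · exact ⟨h', .inr hu, .inl hv⟩
    · have h₁ := hf₁ U
      have h₂ := hYmem U
      rw [hU] at h₁ h₂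
      exact ⟨h₁.1, .inl h₂, h₁.2.2.imp_right .inr⟩
  · rintro u v (⟨hu, hv, h'⟩ | h' | ⟨U, hU⟩)
    · exact ⟨h', .inr (.inr hu), .inr hv⟩
    · exact ⟨(hB u v h').1, (hB u v h').2.1.imp_right .inl, .inl (hB u v h').2.2⟩
    · have h₁ := hf₂ U
      have h₂ := hXmem U
      rw [hU] at h₁ h₂
      exact ⟨h₁.1, h₁.2.1.imp_right .inl, .inr h₂⟩
  · rintro u v (⟨hu, hv, h'⟩ | ⟨hu, hv, h'⟩ | ⟨U, hU⟩) (⟨hu', hv', h''⟩ | h'' | ⟨U', hU'⟩)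
    · exact hXY u hu' hu
    · exact h'.2 h''
    · exact hXY v (by simpa [hU'] using hXmem U') hv
    · exact hXS v hv' hv
    · exact hYS v (hB u v h'').2.2 hv
    · exact hXS v (by simpa [hU'] using hXmem U') hv
    · exact hXY u hu' (by simpa [hU] using hYmem U)
    · have h₁ := (hf₁ U).2.2
      rw [hU] at h₁
      rcases h₁ with h₁ | h₁
      exacts [hYS v (hB u v h'').2.2 h₁, hXY v h₁ (hB u v h'').2.2]
    · exact hf₃ U U' (hU.trans hU'.symm)
  · have hY' := ClosedIn.forall_reach (R := RY) (S := S) (Y := Y)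
      (I := fun u v => (u ∈ Y ∧ v ∈ Y ∧ RY u v) ∨ (u ∈ X ∧ v ∈ S ∧ E u v) ∨
        ∃ U, f (.inl U) = (u, v)) (fun u hu v hv huv => .inl ⟨hu, hv, huv⟩) (fun U hU => by
        have h₁ := hf₁ ⟨U, hU⟩
        refine ⟨_, h₁.2.1, ?_⟩
        rcases h₁.2.2 with h₂ | h₂
        · exact ⟨_, h₂, .single (.inr (.inr ⟨⟨U, hU⟩, rfl⟩))⟩
        · obtain ⟨s, hs, h₃⟩ := hXI _ h₂
          exact ⟨s, hs, .head (.inr (.inr ⟨⟨U, hU⟩, rfl⟩)) h₃⟩)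
    rintro z (hz | hz)
    exacts [hY' z hz, hXI z hz]
  · have hX' := ClosedIn.forall_reach (R := RX) (S := S) (Y := X)
      (I := Function.swap fun u v => (u ∈ X ∧ v ∈ X ∧ E u v) ∨ B u v ∨ ∃ U, f (.inr U) = (u, v))
      (fun u hu v hv huv => .inl ⟨hv, hu, huv⟩) (fun U hU => by
        have h₁ := hf₂ ⟨U, hU⟩
        refine ⟨_, h₁.2.2, ?_⟩
        rcases h₁.2.1 with h₂ | h₂
        · exact ⟨_, h₂, .single (.inr (.inr ⟨⟨U, hU⟩, rfl⟩))⟩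
        · obtain ⟨s, hs, h₃⟩ := hYO _ h₂
          exact ⟨s, hs, .head (.inr (.inr ⟨⟨U, hU⟩, rfl⟩)) (Relation.reflTransGen_swap.2 h₃)⟩)
    rintro z (hz | hz)
    · exact hYO z hz
    · obtain ⟨s, hs, h'⟩ := hX' z hz
      exact ⟨s, hs, Relation.reflTransGen_swap.1 h'⟩

theorem TwoArcStrong.hasSplit_univ_of_forall_reach [Finite α] (hE : TwoArcStrong E)
    (h : HasSplit E S r q) {Y : Set α} (hYS : ∀ y ∈ Y, y ∉ S) {B : α → α → Prop}
    (hB : ∀ u v, B u v → E u v ∧ u ∈ S ∪ Y ∧ v ∈ Y)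
    (hB₁ : ∀ u v u' v', u ∈ Y → u' ∈ Y → B u v → B u' v' → u = u' ∧ v = v')
    (hBr : ∀ y ∈ Y, ∃ s ∈ S, ReflTransGen B s y)
    (hX : ∀ x, x ∉ S → x ∉ Y → ∃ s ∈ S, E x s) : HasSplit E Set.univ r q := by
  have huniv : S ∪ (Y ∪ {x | x ∉ S ∧ x ∉ Y}) = Set.univ := by
    ext x
    simp only [Set.mem_union, Set.mem_ofPred_eq, Set.mem_univ, iff_true]
    tauto
  obtain ⟨s, hs⟩ : S.Nonempty := ⟨r, h.1⟩
  have := h.union_of_cuts (X := {x | x ∉ S ∧ x ∉ Y}) hYS (fun x hx => hx.1) (fun x hx => hx.2)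
    hB hB₁ hBr (fun x hx => hX x hx.1 hx.2) ?_ ?_
  · rwa [huniv] at this
  · intro U hU hne
    rw [huniv, ← Set.compl_eq_univ_sdiff]
    exact hE U hne fun h' => hYS s (hU (h' ▸ Set.mem_univ s)) hs
  · intro U hU hne
    rw [huniv, ← Set.compl_eq_univ_sdiff, ← ncard_arcsBetween_swap]
    exact hE.swap U hne fun h' => (hU (h' ▸ Set.mem_univ s)).1 hs

theorem TwoArcStrong.hasSplit_univ_of_adj [Finite α] (hE : TwoArcStrong E)
    (h : HasSplit E S r q) (hadj : ∀ v, v ∉ S → ∃ s ∈ S, E s v ∨ E v s) :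
    HasSplit E Set.univ r q := by
  refine hE.hasSplit_univ_of_forall_reach h (Y := {v | v ∉ S ∧ ∃ s ∈ S, E s v})
    (B := fun u v => E u v ∧ u ∈ S ∧ v ∉ S) (fun y hy => hy.1) ?_ ?_ ?_ ?_
  · exact fun u v ⟨h₁, h₂, h₃⟩ => ⟨h₁, .inl h₂, h₃, u, h₂, h₁⟩
  · exact fun u v u' v' hu _ h₁ => absurd h₁.2.1 hu.1
  · exact fun y ⟨hy, s, hs, hsy⟩ => ⟨s, hs, .single ⟨hsy, hs, hy⟩⟩
  · intro x hx hxY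
    obtain ⟨s, hs, h' | h'⟩ := hadj x hx
    exacts [absurd ⟨hx, s, hs, h'⟩ hxY, ⟨s, hs, h'⟩]

theorem TwoArcStrong.hasSplit_univ_of_path [Finite α] (hE : TwoArcStrong E)
    (h : HasSplit E S r q) {t p : α} (ht : ∀ s ∈ S, ¬ E s t)
    (hadj : ∀ v, v ∉ S → v ≠ t → ∃ s ∈ S, E s v ∨ E v s) (htS : t ∉ S) (hpS : p ∉ S)
    (hp : ∃ s ∈ S, E s p) (hpt : E p t) :
    HasSplit E Set.univ r q := by
  refine hE.hasSplit_univ_of_forall_reach h (Y := {v | v ∉ S ∧ (v = t ∨ ∃ s ∈ S, E s v)})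
    (B := fun u v => (E u v ∧ u ∈ S ∧ v ∉ S) ∨ (u = p ∧ v = t)) (fun y hy => hy.1) ?_ ?_ ?_ ?_
  · rintro u v (⟨h₁, h₂, h₃⟩ | ⟨rfl, rfl⟩)
    · exact ⟨h₁, .inl h₂, h₃, .inr ⟨u, h₂, h₁⟩⟩
    · exact ⟨hpt, .inr ⟨hpS, .inr hp⟩, htS, .inl rfl⟩
  · rintro u v u' v' hu hu' (h₁ | ⟨rfl, rfl⟩) (h₂ | ⟨rfl, rfl⟩)
    exacts [absurd h₁.2.1 hu.1, absurd h₁.2.1 hu.1, absurd h₂.2.1 hu'.1, ⟨rfl, rfl⟩]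
  · rintro y ⟨hy, rfl | ⟨s, hs, hsy⟩⟩
    · obtain ⟨s, hs, hsp⟩ := hp
      exact ⟨s, hs, .tail (.single (.inl ⟨hsp, hs, hpS⟩)) (.inr ⟨rfl, rfl⟩)⟩
    · exact ⟨s, hs, .single (.inl ⟨hsy, hs, hy⟩)⟩
  · intro x hx hxY
    obtain ⟨s, hs, h' | h'⟩ := hadj x hx fun h' => hxY ⟨hx, .inl h'⟩
    exacts [absurd ⟨hx, .inr ⟨s, hs, h'⟩⟩ hxY, ⟨s, hs, h'⟩]

theorem TwoArcStrong.exists_out [Finite α] (hE : TwoArcStrong E) {U : Set α} (hU : U.Nonempty)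
    (hne : U ≠ Set.univ) : ∃ u ∈ U, ∃ v, v ∉ U ∧ E u v := by
  have h2 := hE U hU hne
  obtain ⟨e, he⟩ := (Set.ncard_pos (s := arcsBetween E U Uᶜ)).1 (by omega)
  exact ⟨e.1, he.2.1, e.2, he.2.2, he.1⟩

theorem TwoArcStrong.exists_in [Finite α] (hE : TwoArcStrong E) {U : Set α} (hU : U.Nonempty)
    (hne : U ≠ Set.univ) : ∃ u ∈ U, ∃ v, v ∉ U ∧ E v u :=
  hE.swap.exists_out hU hne

/-- In a 2-arc-strong digraph a split of `S` extends to all vertices if every vertex outside `S`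
but at most one is adjacent to `S`. -/
theorem TwoArcStrong.hasSplit_univ [Finite α] (hE : TwoArcStrong E) (h : HasSplit E S r q) {t : α}
    (hadj : ∀ v, v ∉ S → v ≠ t → ∃ s ∈ S, E s v ∨ E v s) : HasSplit E Set.univ r q := by
  by_cases htS : t ∈ S ∨ ∃ s ∈ S, E s t ∨ E t s
  · refine hE.hasSplit_univ_of_adj h fun v hv => ?_
    by_cases hvt : v = t
    · exact hvt ▸ htS.resolve_left (hvt ▸ hv)
    · exact hadj v hv hvt
  push Not at htS
  obtain ⟨htS, ht⟩ := htS
  by_cases hp : ∃ p, p ∉ S ∧ (∃ s ∈ S, E s p) ∧ E p t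
  · obtain ⟨p, hpS, hp, hpt⟩ := hp
    exact hE.hasSplit_univ_of_path h (fun s hs => (ht s hs).1) hadj htS hpS hp hpt
  by_cases hn : ∃ n, n ∉ S ∧ (∃ s ∈ S, E n s) ∧ E t n
  · obtain ⟨n, hnS, hn, htn⟩ := hn
    refine (hE.swap.hasSplit_univ_of_path h.swap (t := t) (p := n) (fun s hs => (ht s hs).2)
      (fun v hv hvt => ?_) htS hnS hn htn).swap
    obtain ⟨s, hs, h'⟩ := hadj v hv hvt
    exact ⟨s, hs, h'.symm⟩
  push Not at hp hn
  have hts : r ≠ t := fun h' => htS (h' ▸ h.1)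
  set Y : Set α := {v | v ∉ S ∧ ∃ s ∈ S, E s v} with hY
  set X : Set α := {v | v ∉ S ∧ v ≠ t ∧ ¬ ∃ s ∈ S, E s v} with hX
  have hXout : ∀ x ∈ X, ∃ s ∈ S, E x s := by
    rintro x ⟨hxS, hxt, hx⟩
    obtain ⟨s, hs, h' | h'⟩ := hadj x hxS hxt
    exacts [absurd ⟨s, hs, h'⟩ hx, ⟨s, hs, h'⟩]
  have hcompl : S ∪ (Y ∪ X) = {t}ᶜ := by
    ext x
    simp only [hY, hX, Set.mem_union, Set.mem_ofPred_eq, Set.mem_compl_iff, Set.mem_singleton_iff]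
    constructor
    · rintro (hx | ⟨hx, s, hs, hsx⟩ | ⟨-, hx, -⟩) rfl
      exacts [htS hx, (ht s hs).1 hsx, hx rfl]
    · exact fun hxt => or_iff_not_imp_left.2 fun hxS =>
        (em (∃ s ∈ S, E s x)).imp (fun h' => ⟨hxS, h'⟩) fun h' => ⟨hxS, hxt, h'⟩
  have hmain : HasSplit E (S ∪ (Y ∪ X)) r q := by
    refine h.union_of_cuts (B := fun u v => E u v ∧ u ∈ S ∧ v ∉ S) (fun y hy => hy.1)
      (fun x hx => hx.1) (fun x hx hx' => hx.2.2 hx'.2) ?_ ?_ ?_ hXout ?_ ?_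
    · exact fun u v ⟨h₁, h₂, h₃⟩ => ⟨h₁, .inl h₂, h₃, u, h₂, h₁⟩
    · exact fun u v u' v' hu _ h₁ => absurd h₁.2.1 hu.1
    · exact fun y ⟨hy, s, hs, hsy⟩ => ⟨s, hs, .single ⟨hsy, hs, hy⟩⟩
    · intro U hU hne
      refine (hE U hne fun h' => ?_).trans (Set.ncard_le_ncard ?_)
      · exact (hU (h' ▸ Set.mem_univ r)).1 h.1
      · rintro ⟨u, v⟩ ⟨huv, hu, hv⟩
        refine ⟨huv, hu, hcompl ▸ fun h' => ?_, hv⟩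
        obtain ⟨huS, s, hs, hsu⟩ := hU hu
        exact hp u huS ⟨s, hs, hsu⟩ (h' ▸ huv)
    · intro U hU hne
      rw [← ncard_arcsBetween_swap]
      refine (hE.swap U hne fun h' => ?_).trans (Set.ncard_le_ncard ?_)
      · exact (hU (h' ▸ Set.mem_univ r)).1 h.1
      · rintro ⟨u, v⟩ ⟨huv, hu, hv⟩
        refine ⟨huv, hu, hcompl ▸ fun h' => ?_, hv⟩
        exact hn u (hU hu).1 (hXout u (hU hu)) (h' ▸ huv)
  rw [hcompl] at hmain
  have hne : ({t} : Set α) ≠ Set.univ := fun h' => hts (h' ▸ Set.mem_univ r : r ∈ ({t} : Set α))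
  obtain ⟨_, rfl, w, hw, htw⟩ := hE.exists_out (Set.singleton_nonempty t) hne
  obtain ⟨_, rfl, u, hu, hut⟩ := hE.exists_in (Set.singleton_nonempty _) hne
  have := hmain.insert_of_arcs (fun h' => h' rfl) hu hw hut htw
  rwa [Set.insert_eq, Set.union_compl_self] at this

theorem TwoArcStrong.hasSplit_univ_of_union [Finite α] (hE : TwoArcStrong E)
    (hT : SemiOn E Sᶜ) (h : HasSplit E (S ∪ Z) r q) (hZ : Z.Nonempty) (hZS : ∀ z ∈ Z, z ∉ S) :
    HasSplit E Set.univ r q := by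
  obtain ⟨z, hz⟩ := hZ
  refine hE.hasSplit_univ_of_adj h fun v hv => ⟨z, .inr hz, hT z (hZS z hz) v ?_ ?_⟩
  · exact fun h' => hv (.inl h')
  · rintro rfl
    exact hv (.inr hz)

theorem TwoArcStrong.hasSplit_univ_of_arcs [Finite α] (hE : TwoArcStrong E)
    (hT : SemiOn E Sᶜ) (h : HasSplit E S r q) {u v w : α} (hv : v ∉ S) (hu : u ∈ S) (hw : w ∈ S)
    (huv : E u v) (hvw : E v w) : HasSplit E Set.univ r q := by
  refine hE.hasSplit_univ_of_union hT (Z := {v}) ?_ (Set.singleton_nonempty v) ?_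
  · rw [Set.union_singleton]
    exact h.insert_of_arcs hv hu hw huv hvw
  · rintro _ rfl
    exact hv

theorem TwoArcStrong.hasSplit_univ_of_ncard_compl_le [Finite α] (hE : TwoArcStrong E)
    (hT : SemiOn E Sᶜ) (h : HasSplit E S r q) (hcard : Sᶜ.ncard ≤ 3) :
    HasSplit E Set.univ r q := by
  have hS : S.Nonempty := ⟨r, h.1⟩
  by_cases huniv : S = Set.univ
  · exact huniv ▸ h
  obtain ⟨n, hn, y, hy, hny⟩ := hE.exists_out (Set.nonempty_compl.2 huniv) (by simpa using hS.ne_empty)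
  obtain ⟨p, hp, x, hx, hxp⟩ := hE.exists_in (Set.nonempty_compl.2 huniv) (by simpa using hS.ne_empty)
  rw [Set.mem_compl_iff, not_not] at hx hy
  by_cases hpn : p = n
  · subst hpn
    exact hE.hasSplit_univ_of_arcs hT h hp hx hy hxp hny
  have : Nonempty α := ⟨r⟩
  have hle : (Sᶜ \ {p, n}).ncard ≤ 1 := by
    rw [Set.ncard_sdiff (by grind), Set.ncard_pair hpn]
    omega
  obtain ⟨t, ht⟩ := (Set.ncard_le_one_iff_subset_singleton (Set.toFinite _)).1 hle
  refine hE.hasSplit_univ h (t := t) fun v hv hvt => ?_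
  by_cases hvp : v = p
  · exact ⟨x, hx, .inl (hvp ▸ hxp)⟩
  by_cases hvn : v = n
  · exact ⟨y, hy, .inr (hvn ▸ hny)⟩
  exact absurd (ht ⟨hv, by simp [hvp, hvn]⟩) hvt

theorem HasSplit.union_of_two_entries (h : HasSplit E S r q) {p p' n x x' y : α} (hp : p ∉ S)
    (hp' : p' ∉ S) (hn : n ∉ S) (hx : x ∈ S) (hx' : x' ∈ S) (hy : y ∈ S) (hpp : p ≠ p')
    (hpn : p ≠ n) (hpn' : p' ≠ n) (xp : E x p) (xp' : E x' p') (pp : E p p') (pn : E p n)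
    (pn' : E p' n) (ny : E n y) : HasSplit E (S ∪ {p, p', n}) r q := by
  refine h.union (I' := fun u v => u = n ∧ v = y ∨ u = p' ∧ v = n ∨ u = p ∧ v = p')
    (O' := fun u v => u = x ∧ v = p ∨ u = x' ∧ v = p' ∨ u = p ∧ v = n) ?_ ?_ ?_ ?_ ?_ ?_
  · grind
  · grind
  · grind
  · grind
  · have h₁ := ReflTransGen.single (r := fun u v => u = n ∧ v = y ∨ u = p' ∧ v = n ∨
      u = p ∧ v = p') (a := n) (b := y) (.inl ⟨rfl, rfl⟩)
    have h₂ := h₁.head (a := p') (.inr (.inl ⟨rfl, rfl⟩))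
    have h₃ := h₂.head (a := p) (.inr (.inr ⟨rfl, rfl⟩))
    rintro z (rfl | rfl | rfl)
    exacts [⟨y, hy, h₃⟩, ⟨y, hy, h₂⟩, ⟨y, hy, h₁⟩]
  · have h₁ := ReflTransGen.single (r := fun u v => u = x ∧ v = p ∨ u = x' ∧ v = p' ∨
      u = p ∧ v = n) (a := x) (b := p) (.inl ⟨rfl, rfl⟩)
    have h₂ := h₁.tail (c := n) (.inr (.inr ⟨rfl, rfl⟩))
    rintro z (rfl | rfl | rfl)
    exacts [⟨x, hx, h₁⟩, ⟨x', hx', .single (.inr (.inl ⟨rfl, rfl⟩))⟩, ⟨x, hx, h₂⟩]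

theorem HasSplit.union_of_two_arcs (h : HasSplit E S r q) {p c c' n x y : α} (hp : p ∉ S)
    (hc : c ∉ S) (hc' : c' ∉ S) (hn : n ∉ S) (hx : x ∈ S) (hy : y ∈ S)
    (hd : [p, c, c', n].Nodup) (xp : E x p) (pc : E p c) (pc' : E p c') (cc : E c c')
    (pn : E p n) (cn : E c n) (cn' : E c' n) (ny : E n y) :
    HasSplit E (S ∪ {p, c, c', n}) r q := by
  simp only [List.nodup_cons, List.mem_cons, List.not_mem_nil] at hd
  refine h.union (I' := fun u v => u = n ∧ v = y ∨ u = c' ∧ v = n ∨ u = c ∧ v = c' ∨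
      u = p ∧ v = n)
    (O' := fun u v => u = x ∧ v = p ∨ u = p ∧ v = c ∨ u = p ∧ v = c' ∨ u = c ∧ v = n)
    ?_ ?_ ?_ ?_ ?_ ?_
  · grind
  · grind
  · grind
  · grind
  · have h₁ := ReflTransGen.single (r := fun u v => u = n ∧ v = y ∨ u = c' ∧ v = n ∨
      u = c ∧ v = c' ∨ u = p ∧ v = n) (a := n) (b := y) (.inl ⟨rfl, rfl⟩)
    have h₂ := h₁.head (a := c') (.inr (.inl ⟨rfl, rfl⟩))
    have h₃ := h₂.head (a := c) (.inr (.inr (.inl ⟨rfl, rfl⟩)))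
    have h₄ := h₁.head (a := p) (.inr (.inr (.inr ⟨rfl, rfl⟩)))
    rintro z (rfl | rfl | rfl | rfl)
    exacts [⟨y, hy, h₄⟩, ⟨y, hy, h₃⟩, ⟨y, hy, h₂⟩, ⟨y, hy, h₁⟩]
  · have h₁ := ReflTransGen.single (r := fun u v => u = x ∧ v = p ∨ u = p ∧ v = c ∨
      u = p ∧ v = c' ∨ u = c ∧ v = n) (a := x) (b := p) (.inl ⟨rfl, rfl⟩)
    have h₂ := h₁.tail (c := c) (.inr (.inl ⟨rfl, rfl⟩))
    have h₃ := h₁.tail (c := c') (.inr (.inr (.inl ⟨rfl, rfl⟩)))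
    have h₄ := h₂.tail (c := n) (.inr (.inr (.inr ⟨rfl, rfl⟩)))
    rintro z (rfl | rfl | rfl | rfl)
    exacts [⟨x, hx, h₁⟩, ⟨x, hx, h₂⟩, ⟨x, hx, h₃⟩, ⟨x, hx, h₄⟩]

theorem TwoArcStrong.hasSplit_univ_of_dominates [Finite α] (hE : TwoArcStrong E)
    (hT : SemiOn E Sᶜ) (h : HasSplit E S r q) {C U : Set α} (hC : 2 ≤ C.ncard)
    (hU : U.Nonempty) (hCU : ∀ c ∈ C, c ∉ U) (hunion : ∀ v, v ∉ S ↔ v ∈ C ∨ v ∈ U)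
    (hUC : ∀ u ∈ U, ∀ c ∈ C, ¬ E u c) : HasSplit E Set.univ r q := by
  have hdom : ∀ c ∈ C, ∀ u ∈ U, E c u := fun c hc u hu =>
    (hT c ((hunion c).2 (.inl hc)) u ((hunion u).2 (.inr hu)) fun h' => hCU c hc (h' ▸ hu)).resolve_right
      (hUC u hu c hc)
  have hne : ∀ W : Set α, (∀ w ∈ W, w ∉ S) → W ≠ Set.univ := by
    rintro _ hW rfl
    exact hW r trivial h.1
  have hCS : ∀ c ∈ C, c ∉ S := fun c hc => (hunion c).2 (.inl hc)
  have hUS : ∀ c ∈ U, c ∉ S := fun c hc => (hunion c).2 (.inr hc)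
  obtain ⟨n, hn, y, hy, hny⟩ := hE.exists_out hU (hne _ hUS)
  have hyS : y ∈ S := by_contra fun h' => ((hunion y).1 h').elim (hUC n hn y · hny) hy
  obtain ⟨p, hp, x, hx, hxp⟩ :=
    hE.exists_in ((Set.ncard_pos (s := C)).1 (by omega)) (hne _ hCS)
  have hxS : x ∈ S := by_contra fun h' => ((hunion x).1 h').elim hx (hUC x · p hp hxp)
  have hCn : ∀ c ∈ C, c ≠ n := fun c hc h' => hCU c hc (h' ▸ hn)
  by_cases hp' : ∃ p' ∈ C, p' ≠ p ∧ ∃ x' ∈ S, E x' p'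
  · obtain ⟨p', hp', hpp, x', hx', hxp'⟩ := hp'
    rcases hT p (hCS p hp) p' (hCS p' hp') hpp.symm with h' | h'
    · exact hE.hasSplit_univ_of_union hT (h.union_of_two_entries (hCS p hp) (hCS p' hp')
        (hUS n hn) hxS hx' hyS hpp.symm (hCn p hp) (hCn p' hp') hxp hxp' h' (hdom p hp n hn)
        (hdom p' hp' n hn) hny) ⟨p, .inl rfl⟩ (by
          rintro z (rfl | rfl | rfl)
          exacts [hCS _ hp, hCS _ hp', hUS _ hn])
    · exact hE.hasSplit_univ_of_union hT (h.union_of_two_entries (hCS p' hp') (hCS p hp)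
        (hUS n hn) hx' hxS hyS hpp (hCn p' hp') (hCn p hp) hxp' hxp h' (hdom p' hp' n hn)
        (hdom p hp n hn) hny) ⟨p', .inl rfl⟩ (by
          rintro z (rfl | rfl | rfl)
          exacts [hCS _ hp', hCS _ hp, hUS _ hn])
  push Not at hp'
  have hCp : (C \ {p}).Nonempty := by
    rw [← Set.ncard_pos, Set.ncard_sdiff_singleton_of_mem hp]
    omega
  have h2 := hE.swap (C \ {p}) hCp (hne _ fun w hw => hCS w hw.1)
  have htail : ∀ c ∈ C \ {p}, ∀ u, u ∉ C \ {p} → E u c → u = p := by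
    intro c hc u hu huc
    by_contra hup
    by_cases huS : u ∈ S
    · exact hp' c hc.1 hc.2 u huS huc
    · exact ((hunion u).1 huS).elim (fun h' => hu ⟨h', hup⟩) (hUC u · c hc.1 huc)
  obtain ⟨⟨c, u⟩, ⟨c', u'⟩, ⟨huc, hc, hu⟩, ⟨huc', hc', hu'⟩, hcc⟩ := (Set.one_lt_ncard_iff (Set.toFinite _)).1 h2
  obtain rfl : u = p := htail c hc u hu huc
  obtain rfl : u' = u := htail c' hc' u' hu' huc'
  replace hcc : c ≠ c' := fun h' => hcc (by rw [h'])
  have key : ∀ c ∈ C \ {u'}, ∀ c' ∈ C \ {u'}, c ≠ c' → E u' c → E u' c' → E c c' →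
      HasSplit E Set.univ r q := by
    intro c hc c' hc' hcc huc huc' h'
    have hcp : u' ≠ c := fun h' => hc.2 h'.symm
    have hcp' : u' ≠ c' := fun h' => hc'.2 h'.symm
    refine hE.hasSplit_univ_of_union hT (h.union_of_two_arcs (hCS u' hp) (hCS c hc.1)
      (hCS c' hc'.1) (hUS n hn) hxS hyS ?_ hxp huc huc' h' (hdom u' hp n hn) (hdom c hc.1 n hn)
      (hdom c' hc'.1 n hn) hny) ⟨u', .inl rfl⟩ ?_
    · simp [hcp, hcp', hcc, hCn u' hp, hCn c hc.1, hCn c' hc'.1]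
    · rintro z (rfl | rfl | rfl | rfl)
      exacts [hCS _ hp, hCS _ hc.1, hCS _ hc'.1, hUS _ hn]
  rcases hT c (hCS c hc.1) c' (hCS c' hc'.1) hcc with h' | h'
  · exact key c hc c' hc' hcc huc huc' h'
  · exact key c' hc' c hc hcc.symm huc' huc h'

theorem TwoArcStrong.hasSplit_univ_of_not_strongOn [Finite α] (hE : TwoArcStrong E)
    (hT : SemiOn E Sᶜ) (h : HasSplit E S r q) (hcard : 3 ≤ Sᶜ.ncard) (hstr : ¬ StrongOn E Sᶜ) :
    HasSplit E Set.univ r q := by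
  unfold StrongOn at hstr
  push Not at hstr
  obtain ⟨U, hUS, hU, hne, hno⟩ := hstr
  have hno' : ∀ u ∈ U, ∀ c ∈ Sᶜ \ U, ¬ E u c := fun u hu c hc => hno u hu c hc.1 hc.2
  have hunion : ∀ v, v ∉ S ↔ v ∈ Sᶜ \ U ∨ v ∈ U := fun v =>
    ⟨fun hv => (em (v ∈ U)).symm.imp_left fun h' => ⟨hv, h'⟩, fun hv => hv.elim (·.1) (hUS ·)⟩
  have hcards := Set.ncard_sdiff_add_ncard_of_subset hUS
  by_cases hC : 2 ≤ (Sᶜ \ U).ncard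
  · exact hE.hasSplit_univ_of_dominates hT h hC hU (fun c hc => hc.2) hunion hno'
  · refine (hE.swap.hasSplit_univ_of_dominates hT.swap h.swap (C := U) (U := Sᶜ \ U) (by omega)
      ?_ (fun c hc hc' => hc'.2 hc) (fun v => (hunion v).trans or_comm)
      fun u hu c hc => hno' c hc u hu).swap
    rw [Set.sdiff_nonempty]
    exact fun h' => hne (hUS.antisymm h')

theorem TwoArcStrong.exists_hasSplit_of_strongOn [Finite α] (hE : TwoArcStrong E)
    (hT : SemiOn E T) (hstr : StrongOn E T) (hcard : 4 ≤ T.ncard) (hq : q ∈ T)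
    (hout : ∀ v, v ∉ T → ¬ E q v) : ∃ r, HasSplit E T r q := by
  have hne : ({q} : Set α) ≠ Set.univ := by
    intro h'
    have := Set.ncard_le_ncard (h' ▸ Set.subset_univ T : T ⊆ {q})
    rw [Set.ncard_singleton] at this
    omega
  obtain ⟨⟨u, a⟩, ⟨u', b⟩, ⟨hua, rfl, ha⟩, ⟨hub, rfl, hb⟩, hab⟩ :=
    (Set.one_lt_ncard_iff (Set.toFinite _)).1 (hE {q} (Set.singleton_nonempty q) hne)
  have haq : u' ≠ a := fun h' => ha h'.symm
  have hbq : u' ≠ b := fun h' => hb h'.symm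
  replace hab : a ≠ b := fun h' => hab (by rw [h'])
  have haT : a ∈ T := by_contra fun h' => hout a h' hua
  have hbT : b ∈ T := by_contra fun h' => hout b h' hub
  obtain ⟨c, hc, hcn⟩ : ∃ c ∈ T, c ∉ ({u', a, b} : Set α) := by
    by_contra! hno
    have := Set.ncard_le_ncard hno
    have h3 := Set.ncard_insert_le u' {a, b}
    rw [Set.ncard_pair hab] at h3
    omega
  refine hstr.exists_hasSplit hT hq haT hbT hc ?_ hua hub
  simp only [Set.mem_insert_iff, Set.mem_singleton_iff, not_or] at hcn
  simp [haq, hbq, hab, Ne.symm hcn.1, Ne.symm hcn.2.1, Ne.symm hcn.2.2]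

theorem TwoArcStrong.exists_hasSplit_univ_of_four_le [Finite α] (hE : TwoArcStrong E)
    (hS : SemiOn E S) (hT : SemiOn E Sᶜ) (hScard : 4 ≤ S.ncard) (hTcard : 4 ≤ Sᶜ.ncard) :
    ∃ r q, HasSplit E Set.univ r q := by
  obtain ⟨r, q, h⟩ := hS.exists_hasSplit hScard
  obtain ⟨r', q', h'⟩ := hT.exists_hasSplit hTcard
  by_cases hTstr : StrongOn E Sᶜ
  swap
  · exact ⟨r, q, hE.hasSplit_univ_of_not_strongOn hT h (by omega) hTstr⟩
  by_cases hSstr : StrongOn E S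
  swap
  · rw [← compl_compl S] at hS hScard hSstr
    exact ⟨r', q', hE.hasSplit_univ_of_not_strongOn hS h' (by omega) hSstr⟩
  have hSne : S.Nonempty := ⟨r, h.1⟩
  obtain ⟨⟨a, b⟩, ⟨a', b'⟩, ⟨hab, ha, hb⟩, ⟨hab', ha', hb'⟩, hne⟩ :=
    (Set.one_lt_ncard_iff (Set.toFinite _)).1 (hE S hSne fun h₁ => (h₁ ▸ h'.1 : r' ∈ Set.univᶜ) trivial)
  by_cases ha₂ : ∃ v, v ∉ S ∧ E v a
  · obtain ⟨v, hv, hva⟩ := ha₂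
    have hS' := hS
    rw [← compl_compl S] at hS'
    exact ⟨r', q', hE.hasSplit_univ_of_arcs hS' h' (fun h₁ => h₁ ha) hv hb hva hab⟩
  by_cases hb₂ : ∃ v ∈ S, E b' v
  · obtain ⟨v, hv, hbv⟩ := hb₂
    exact ⟨r, q, hE.hasSplit_univ_of_arcs hT h hb' ha' hv hab' hbv⟩
  push Not at ha₂ hb₂
  obtain ⟨r₂, h₂⟩ := hE.exists_hasSplit_of_strongOn hT hTstr hTcard hb'
    fun v hv => hb₂ v (not_not.1 hv)
  obtain ⟨q₁, h₁⟩ := hE.swap.exists_hasSplit_of_strongOn hS.swap hSstr.swap hScard ha ha₂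
  have := HasSplit.join (HasSplit.swap h₁) h₂ (fun v hv hv' => hv' hv) hb ha' hab hab'
    fun h₁ => hne (Prod.ext h₁.1 h₁.2)
  rw [Set.union_compl_self] at this
  exact ⟨r₂, q₁, this⟩

theorem TwoArcStrong.exists_hasSplit_univ_of_le_three [Finite α] [Nonempty α]
    (hE : TwoArcStrong E) (hS : SemiOn E S) (hT : SemiOn E Sᶜ) (hScard : S.ncard ≤ 3)
    (hTcard : Sᶜ.ncard ≤ 3) : ∃ r q, HasSplit E Set.univ r q := by
  by_cases hcyc : ∃ a b, a ≠ b ∧ E a b ∧ E b a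
  · obtain ⟨a, b, hne, hab, hba⟩ := hcyc
    have h := (hasSplit_singleton E a).insert_of_arcs (v := b) (fun h' => hne h'.symm) rfl rfl
      hab hba
    have hnt : (insert b {a} : Set α).Nontrivial := ⟨b, .inl rfl, a, .inr rfl, hne.symm⟩
    have key : ∀ T : Set α, a ∈ T → b ∈ T → SemiOn E T → SemiOn E Tᶜ → Tᶜ.ncard ≤ 3 →
        ∃ r q, HasSplit E Set.univ r q := by
      intro T ha hb hT hT' hcard
      obtain ⟨r, q, h'⟩ := h.exists_of_subset hnt (by
        rintro _ (rfl | rfl)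
        exacts [hb, ha]) hT
      exact ⟨r, q, hE.hasSplit_univ_of_ncard_compl_le hT' h' hcard⟩
    by_cases ha : a ∈ S <;> by_cases hb : b ∈ S
    · exact key S ha hb hS hT hTcard
    · refine ⟨a, a, hE.hasSplit_univ_of_adj h fun v hv => ?_⟩
      simp only [Set.mem_insert_iff, Set.mem_singleton_iff, not_or] at hv
      by_cases hvS : v ∈ S
      · exact ⟨a, .inr rfl, hS a ha v hvS (Ne.symm hv.2)⟩
      · exact ⟨b, .inl rfl, hT b hb v hvS (Ne.symm hv.1)⟩
    · refine ⟨a, a, hE.hasSplit_univ_of_adj h fun v hv => ?_⟩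
      simp only [Set.mem_insert_iff, Set.mem_singleton_iff, not_or] at hv
      by_cases hvS : v ∈ S
      · exact ⟨b, .inl rfl, hS b hb v hvS (Ne.symm hv.1)⟩
      · exact ⟨a, .inr rfl, hT a ha v hvS (Ne.symm hv.2)⟩
    · exact key Sᶜ ha hb hT (by rwa [compl_compl]) (by rwa [compl_compl])
  push Not at hcyc
  obtain ⟨v⟩ := ‹Nonempty α›
  have hv := hasSplit_singleton E v
  by_cases huniv : ({v} : Set α) = Set.univ
  · exact ⟨v, v, huniv ▸ hv⟩
  refine ⟨v, v, ?_⟩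
  have hle : {w | w ≠ v ∧ ¬ E v w ∧ ¬ E w v}.ncard ≤ 1 := by
    by_contra! hlt
    obtain ⟨x, y, ⟨hx, hx₁, hx₂⟩, ⟨hy, hy₁, hy₂⟩, hxy⟩ := (Set.one_lt_ncard_iff (Set.toFinite _)).1 hlt
    obtain ⟨⟨_, a⟩, ⟨_, b⟩, ⟨hva, rfl, ha⟩, ⟨hvb, rfl, hb⟩, hab⟩ :=
      (Set.one_lt_ncard_iff (Set.toFinite _)).1 (hE {v} (Set.singleton_nonempty v) huniv)
    obtain ⟨⟨_, c⟩, ⟨_, d⟩, ⟨hvc, rfl, hc⟩, ⟨hvd, hvd', hd⟩, hcd⟩ :=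
      (Set.one_lt_ncard_iff (Set.toFinite _)).1 (hE.swap _ (Set.singleton_nonempty _) huniv)
    have := Fintype.ofFinite α
    simp only [Function.swap, Set.mem_singleton_iff, Set.mem_compl_iff] at *
    subst hvd'
    rename_i v
    have hnd : [v, a, b, c, d, x, y].Nodup := by
      simp only [List.nodup_cons, List.mem_cons, List.not_mem_nil]
      grind (splits := 30)
    have h7 := hnd.length_le_card
    have := Set.ncard_add_ncard_compl S
    rw [Nat.card_eq_fintype_card] at this
    simp only [List.length_cons, List.length_nil] at h7
    omega
  have : Nonempty α := ⟨v⟩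
  obtain ⟨t, ht⟩ := (Set.ncard_le_one_iff_subset_singleton (Set.toFinite _)).1 hle
  refine hE.hasSplit_univ hv (t := t) fun w hw hwt => ⟨v, rfl, ?_⟩
  by_contra! hno
  exact hwt (ht ⟨hw, hno.1, hno.2⟩)

theorem TwoArcStrong.exists_hasSplit_univ [Finite α] [Nonempty α]
    (hE : TwoArcStrong E) (hS : SemiOn E S) (hT : SemiOn E Sᶜ) :
    ∃ r q, HasSplit E Set.univ r q := by
  by_cases h₁ : 4 ≤ S.ncard <;> by_cases h₂ : 4 ≤ Sᶜ.ncard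
  · exact hE.exists_hasSplit_univ_of_four_le hS hT h₁ h₂
  · obtain ⟨r, q, h⟩ := hS.exists_hasSplit h₁
    exact ⟨r, q, hE.hasSplit_univ_of_ncard_compl_le hT h (by omega)⟩
  · obtain ⟨r, q, h⟩ := hT.exists_hasSplit h₂
    exact ⟨r, q, hE.hasSplit_univ_of_ncard_compl_le (by rwa [compl_compl]) h
      (by rw [compl_compl]; omega)⟩
  · exact hE.exists_hasSplit_univ_of_le_three hS hT (by omega) (by omega)

theorem ReflTransGen.exists_of_forall_mem_or {O B : α → α → Prop} {v w : α}
    (hB : ∀ a b, O a b → b ≠ v → B a b) (h : ReflTransGen O q w) :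
    ReflTransGen B q w ∨ ∃ a, ReflTransGen B q a ∧ O a v := by
  induction h with
  | refl => exact .inl .refl
  | @tail b c _ hbc ih =>
    rcases ih with ih | ih
    · by_cases hc : c = v
      · exact .inr ⟨b, ih, hc ▸ hbc⟩
      · exact .inl (ih.tail (hB b c hbc hc))
    · exact .inr ih

/-- If every vertex is reachable from `q`, then some subrelation is an out-branching. -/
theorem exists_outBranching [Finite α] {O : α → α → Prop} (hO : ∀ v, ReflTransGen O q v) :
    ∃ B ≤ O, (∀ v, ReflTransGen B q v) ∧ ∀ v, v ≠ q → ∃! u, B u v := by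
  obtain ⟨B, hBO, hB⟩ := exists_minimal_le_of_wellFoundedLT
    (fun B : α → α → Prop => ∀ v, ReflTransGen B q v) O hO
  refine ⟨B, hBO, hB.prop, fun v hv => ?_⟩
  obtain ⟨a, ha, hav⟩ : ∃ a, ReflTransGen (fun x y => B x y ∧ y ≠ v) q a ∧ B a v := by
    refine (ReflTransGen.exists_of_forall_mem_or (fun a b h h' => ⟨h, h'⟩) (hB.prop v)).resolve_left
      fun h' => ?_
    rcases h'.cases_tail with rfl | ⟨c, -, hc⟩
    exacts [hv rfl, hc.2 rfl]
  have hB' : ∀ w, ReflTransGen (fun x y => B x y ∧ (y = v → x = a)) q w := by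
    have hqa : ReflTransGen (fun x y => B x y ∧ (y = v → x = a)) q a :=
      ReflTransGen.mono (fun _ _ h => ⟨h.1, fun h' => absurd h' h.2⟩) _ _ ha
    have hqv := hqa.tail (c := v) ⟨hav, fun _ => rfl⟩
    intro w
    induction hB.prop w with
    | refl => exact .refl
    | @tail b c _ hbc ih =>
      by_cases hc : c = v
      · exact hc ▸ hqv
      · exact ih.tail ⟨hbc, fun h' => absurd h' hc⟩
  exact ⟨a, hav, fun u hu => (hB.le_of_le hB' (fun x y h => h.1) u v hu).2 rfl⟩

end Split

theorem SemicompleteOn.semiOn {V : Type*} {S : Finset V} {A : Finset (V × V)}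
    (h : SemicompleteOn S A) : SemiOn (fun u v => (u, v) ∈ A) (S : Set V) :=
  fun u hu v hv => h u hu v hv

theorem ArcConnAtLeast.twoArcStrong {V : Type*} [Fintype V] [DecidableEq V] {A : Finset (V × V)}
    (h : ArcConnAtLeast A 2) : TwoArcStrong (fun u v => (u, v) ∈ A) := by
  classical
  intro U hU hne
  refine (h U.toFinset (by simpa using hU) (by simpa using hne)).trans_eq ?_
  rw [cutCard, ← Set.ncard_coe_finset]
  congr 1
  ext e
  simp [arcsBetween]

theorem isOutBranching_of_reach {V : Type*} [Fintype V] [DecidableEq V] {A : Finset (V × V)}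
    {O : V → V → Prop} {q : V} (hOA : ∀ u v, O u v → (u, v) ∈ A)
    (hO : ∀ v, ReflTransGen O q v) :
    ∃ B, IsOutBranching Finset.univ A B q ∧ ∀ e ∈ B, O e.1 e.2 := by
  classical
  obtain ⟨B, hBO, hB, huniq⟩ := exists_outBranching hO
  refine ⟨Finset.univ.filter fun e => B e.1 e.2, ⟨Finset.mem_univ q, fun e he => ?_, by simp,
    fun v _ => ?_, fun v _ hv => ?_⟩, fun e he => ?_⟩
  · exact hOA e.1 e.2 (hBO _ _ (Finset.mem_filter.1 he).2)
  · exact ReflTransGen.mono (fun a b h => by simpa using h) _ _ (hB v)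
  · obtain ⟨u, hu, huu⟩ := huniq v hv
    refine Finset.card_eq_one.2 ⟨(u, v), ?_⟩
    ext ⟨a, b⟩
    simp only [Finset.mem_filter, Finset.mem_univ, true_and, Finset.mem_singleton, Prod.mk.injEq]
    constructor
    · rintro ⟨h, rfl⟩
      exact ⟨huu a h, rfl⟩
    · rintro ⟨rfl, rfl⟩
      exact ⟨hu, rfl⟩
  · exact hBO _ _ (Finset.mem_filter.1 he).2

theorem isInBranching_of_reach {V : Type*} [Fintype V] [DecidableEq V] {A : Finset (V × V)}
    {I : V → V → Prop} {r : V} (hIA : ∀ u v, I u v → (u, v) ∈ A)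
    (hI : ∀ v, ReflTransGen I v r) :
    ∃ B, IsInBranching Finset.univ A B r ∧ ∀ e ∈ B, I e.1 e.2 := by
  classical
  obtain ⟨B, hBI, hB, huniq⟩ := exists_outBranching (O := Function.swap I)
    fun v => Relation.reflTransGen_swap.2 (hI v)
  refine ⟨Finset.univ.filter fun e => B e.2 e.1, ⟨Finset.mem_univ r, fun e he => ?_, by simp,
    fun v _ => ?_, fun v _ hv => ?_⟩, fun e he => ?_⟩
  · exact hIA e.1 e.2 (hBI _ _ (Finset.mem_filter.1 he).2)
  · exact ReflTransGen.mono (fun a b h => by simpa using h) _ _ (Relation.reflTransGen_swap.2 (hB v))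
  · obtain ⟨u, hu, huu⟩ := huniq v hv
    refine Finset.card_eq_one.2 ⟨(v, u), ?_⟩
    ext ⟨a, b⟩
    simp only [Finset.mem_filter, Finset.mem_univ, true_and, Finset.mem_singleton, Prod.mk.injEq]
    constructor
    · rintro ⟨h, rfl⟩
      exact ⟨rfl, huu b h⟩
    · rintro ⟨rfl, rfl⟩
      exact ⟨hu, rfl⟩
  · exact hBI _ _ (Finset.mem_filter.1 he).2

theorem HasSplit.goodPair {V : Type*} [Fintype V] [DecidableEq V] {A : Finset (V × V)} {r q : V}
    (h : HasSplit (fun u v => (u, v) ∈ A) Set.univ r q) : GoodPair Finset.univ A := by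
  obtain ⟨-, -, I, O, hI, hO, hd, hIr, hOq⟩ := h
  obtain ⟨I', hI', hII⟩ := isInBranching_of_reach (fun u v h => (hI u v h).1)
    fun v => hIr v trivial
  obtain ⟨O', hO', hOO⟩ := isOutBranching_of_reach (fun u v h => (hO u v h).1)
    fun v => hOq v trivial
  exact ⟨I', O', r, q, hI', hO', Finset.disjoint_left.2 fun e he he' =>
    hd _ _ (hII e he) (hOO e he')⟩

/-- Every co-bipartite digraph with arc-connectivity at least 2
has a good pair. -/
theorem stmt1 {V : Type*} [Fintype V] [DecidableEq V] [Nonempty V]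
    (A : Finset (V × V)) (hirr : ∀ e ∈ A, e.1 ≠ e.2)
    (hcb : CoBipartite A) (hconn : ArcConnAtLeast A 2) :
    GoodPair Finset.univ A := by
  obtain ⟨S, hS, hT⟩ := hcb
  have hT' := hT.semiOn
  rw [Finset.coe_compl] at hT'
  obtain ⟨r, q, h⟩ := hconn.twoArcStrong.exists_hasSplit_univ hS.semiOn hT'
  exact h.goodPair
end

section
/- Every semicomplete digraph D on at least 4 vertices has a good pair. -/
/-!
Digraphs are modelled by a finite vertex type `V` (with decidable equality) together with
an arc set `A : Finset (V × V)`; irreflexivity (`∀ e ∈ A, e.1 ≠ e.2`) is stated as a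
hypothesis.  Subdigraphs on a vertex set `S : Finset V` use arcs with both endpoints in `S`.
-/

variable {V : Type*} [Fintype V] [DecidableEq V]

omit [Fintype V] [DecidableEq V] in
theorem Reach.mono {B C : Finset (V × V)} (h : B ⊆ C) {u v : V} (huv : Reach B u v) :
    Reach C u v :=
  Relation.ReflTransGen.mono (fun _ _ hab => h hab) u v huv

omit [Fintype V] in
/-- The out-branching consisting of a single vertex. -/
theorem isOutBranching_singleton (A : Finset (V × V)) (q : V) :
    IsOutBranching {q} A ∅ q := by
  refine ⟨by simp, by simp, by simp, ?_, ?_⟩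
  · intro v hv
    rw [Finset.mem_singleton.mp hv]
    exact Relation.ReflTransGen.refl
  · intro v hv hne
    exact absurd (Finset.mem_singleton.mp hv) hne

omit [Fintype V] in
/-- The in-branching consisting of a single vertex. -/
theorem isInBranching_singleton (A : Finset (V × V)) (r : V) :
    IsInBranching {r} A ∅ r := by
  refine ⟨by simp, by simp, by simp, ?_, ?_⟩
  · intro v hv
    rw [Finset.mem_singleton.mp hv]
    exact Relation.ReflTransGen.refl
  · intro v hv hne
    exact absurd (Finset.mem_singleton.mp hv) hne

omit [Fintype V] in
/-- A new vertex can be attached to an out-branching by an arc into it. -/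
theorem IsOutBranching.insert {S : Finset V} {A B : Finset (V × V)} {q u v : V}
    (h : IsOutBranching S A B q) (hu : u ∈ S) (hv : v ∉ S) (huv : (u, v) ∈ A) :
    IsOutBranching (insert v S) A (insert (u, v) B) q := by
  obtain ⟨hq, hBA, hBS, hreach, hdeg⟩ := h
  refine ⟨Finset.mem_insert_of_mem hq, Finset.insert_subset huv hBA, ?_, ?_, ?_⟩
  · intro e he
    rcases Finset.mem_insert.mp he with rfl | he
    · exact ⟨Finset.mem_insert_of_mem hu, Finset.mem_insert_self _ _⟩
    · exact ⟨Finset.mem_insert_of_mem (hBS e he).1, Finset.mem_insert_of_mem (hBS e he).2⟩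
  · intro w hw
    rcases Finset.mem_insert.mp hw with rfl | hw
    · exact Relation.ReflTransGen.tail ((hreach u hu).mono (Finset.subset_insert _ _))
        (Finset.mem_insert_self _ _)
    · exact (hreach w hw).mono (Finset.subset_insert _ _)
  · intro w hw hwq
    rcases Finset.mem_insert.mp hw with rfl | hw
    · have hempty : B.filter (fun e => e.2 = w) = ∅ :=
        Finset.filter_eq_empty_iff.mpr fun e he h => hv (h ▸ (hBS e he).2)
      rw [Finset.filter_insert, if_pos rfl, hempty]
      rfl
    · have hne : v ≠ w := fun h => hv (h ▸ hw)
      rw [Finset.filter_insert, if_neg hne]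
      exact hdeg w hw hwq

omit [Fintype V] in
/-- A new vertex can be attached to an in-branching by an arc out of it. -/
theorem IsInBranching.insert {S : Finset V} {A B : Finset (V × V)} {r v w : V}
    (h : IsInBranching S A B r) (hw : w ∈ S) (hv : v ∉ S) (hvw : (v, w) ∈ A) :
    IsInBranching (insert v S) A (insert (v, w) B) r := by
  obtain ⟨hr, hBA, hBS, hreach, hdeg⟩ := h
  refine ⟨Finset.mem_insert_of_mem hr, Finset.insert_subset hvw hBA, ?_, ?_, ?_⟩
  · intro e he
    rcases Finset.mem_insert.mp he with rfl | he
    · exact ⟨Finset.mem_insert_self _ _, Finset.mem_insert_of_mem hw⟩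
    · exact ⟨Finset.mem_insert_of_mem (hBS e he).1, Finset.mem_insert_of_mem (hBS e he).2⟩
  · intro u hu
    rcases Finset.mem_insert.mp hu with rfl | hu
    · exact Relation.ReflTransGen.head (Finset.mem_insert_self _ _)
        ((hreach w hw).mono (Finset.subset_insert _ _))
    · exact (hreach u hu).mono (Finset.subset_insert _ _)
  · intro u hu hur
    rcases Finset.mem_insert.mp hu with rfl | hu
    · have hempty : B.filter (fun e => e.1 = u) = ∅ :=
        Finset.filter_eq_empty_iff.mpr fun e he h => hv (h ▸ (hBS e he).1)
      rw [Finset.filter_insert, if_pos rfl, hempty]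
      rfl
    · have hne : v ≠ u := fun h => hv (h ▸ hu)
      rw [Finset.filter_insert, if_neg hne]
      exact hdeg u hu hur

omit [Fintype V] in
/-- A good pair extends to a new vertex that has both an in-neighbour and an out-neighbour. -/
theorem GoodPair.insert {S : Finset V} {A : Finset (V × V)} {u v w : V}
    (h : GoodPair S A) (hu : u ∈ S) (hw : w ∈ S) (hv : v ∉ S)
    (huv : (u, v) ∈ A) (hvw : (v, w) ∈ A) : GoodPair (insert v S) A := by
  obtain ⟨I, O, r, q, hI, hO, hdisj⟩ := h
  refine ⟨_, _, r, q, hI.insert hw hv hvw, hO.insert hu hv huv, ?_⟩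
  rw [Finset.disjoint_insert_left, Finset.disjoint_insert_right]
  refine ⟨fun hmem => ?_, fun hmem => hv (hI.2.2.1 _ hmem).2, hdisj⟩
  rcases Finset.mem_insert.mp hmem with heq | hmem
  · exact hv ((Prod.mk.inj heq).1 ▸ hu)
  · exact hv (hO.2.2.1 _ hmem).1

omit [Fintype V] in
/-- The out-branching on four vertices rooted at `a` in which `b`, `c`, `d` are attached in this
order. -/
theorem isOutBranching_four {A : Finset (V × V)} {S : Finset V} {a b c d x y : V}
    (hS : S = {d, c, b, a}) (hb : b ∉ ({a} : Finset V)) (hc : c ∉ ({b, a} : Finset V))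
    (hd : d ∉ ({c, b, a} : Finset V)) (hx : x ∈ ({b, a} : Finset V))
    (hy : y ∈ ({c, b, a} : Finset V)) (hab : (a, b) ∈ A) (hxc : (x, c) ∈ A)
    (hyd : (y, d) ∈ A) : IsOutBranching S A {(y, d), (x, c), (a, b)} a := by
  subst hS
  exact (((isOutBranching_singleton A a).insert (Finset.mem_singleton_self a) hb hab).insert
    hx hc hxc).insert hy hd hyd

omit [Fintype V] in
/-- The in-branching on four vertices rooted at `a` in which `b`, `c`, `d` are attached in this
order. -/
theorem isInBranching_four {A : Finset (V × V)} {S : Finset V} {a b c d x y : V}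
    (hS : S = {d, c, b, a}) (hb : b ∉ ({a} : Finset V)) (hc : c ∉ ({b, a} : Finset V))
    (hd : d ∉ ({c, b, a} : Finset V)) (hx : x ∈ ({b, a} : Finset V))
    (hy : y ∈ ({c, b, a} : Finset V)) (hba : (b, a) ∈ A) (hcx : (c, x) ∈ A)
    (hdy : (d, y) ∈ A) : IsInBranching S A {(d, y), (c, x), (b, a)} a := by
  subst hS
  exact (((isInBranching_singleton A a).insert (Finset.mem_singleton_self a) hb hba).insert
    hx hc hcx).insert hy hd hdy

omit [Fintype V] in
/-- A semicomplete digraph on four vertices, given with a Hamiltonian path, has a good pair. -/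
theorem goodPair_of_hamiltonian_path {A : Finset (V × V)} {a b c d : V}
    (hab : a ≠ b) (hac : a ≠ c) (had : a ≠ d) (hbc : b ≠ c) (hbd : b ≠ d) (hcd : c ≠ d)
    (hsc : SemicompleteOn {a, b, c, d} A)
    (ab : (a, b) ∈ A) (bc : (b, c) ∈ A) (cd : (c, d) ∈ A) : GoodPair {a, b, c, d} A := by
  have hac' := hsc a (by simp) c (by simp) hac
  have had' := hsc a (by simp) d (by simp) had
  have hbd' := hsc b (by simp) d (by simp) hbd
  rcases hac' with ac | ca <;> rcases hbd' with bd | db <;> rcases had' with ad | da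
  · exact ⟨_, _, d, a,
      isInBranching_four (by grind) (by grind) (by grind) (by grind) (by grind) (by grind)
        cd ac bd,
      isOutBranching_four (by grind) (by grind) (by grind) (by grind) (by grind) (by grind)
        ab bc ad,
      by simp [*, Ne.symm]⟩
  · exact ⟨_, _, d, d,
      isInBranching_four (by grind) (by grind) (by grind) (by grind) (by grind) (by grind)
        cd ac bd,
      isOutBranching_four (by grind) (by grind) (by grind) (by grind) (by grind) (by grind)
        da ab bc,
      by simp [*, Ne.symm]⟩
  · exact ⟨_, _, b, a,
      isInBranching_four (by grind) (by grind) (by grind) (by grind) (by grind) (by grind)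
        db cd ac,
      isOutBranching_four (by grind) (by grind) (by grind) (by grind) (by grind) (by grind)
        ab bc ad,
      by simp [*, Ne.symm]⟩
  · exact ⟨_, _, b, d,
      isInBranching_four (by grind) (by grind) (by grind) (by grind) (by grind) (by grind)
        db cd ac,
      isOutBranching_four (by grind) (by grind) (by grind) (by grind) (by grind) (by grind)
        da ab bc,
      by simp [*, Ne.symm]⟩
  · exact ⟨_, _, d, c,
      isInBranching_four (by grind) (by grind) (by grind) (by grind) (by grind) (by grind)
        cd bc ad,
      isOutBranching_four (by grind) (by grind) (by grind) (by grind) (by grind) (by grind)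
        ca ab bd,
      by simp [*, Ne.symm]⟩
  · exact ⟨_, _, a, c,
      isInBranching_four (by grind) (by grind) (by grind) (by grind) (by grind) (by grind)
        da cd bc,
      isOutBranching_four (by grind) (by grind) (by grind) (by grind) (by grind) (by grind)
        ca ab bd,
      by simp [*, Ne.symm]⟩
  · exact ⟨_, _, b, a,
      isInBranching_four (by grind) (by grind) (by grind) (by grind) (by grind) (by grind)
        db ad ca,
      isOutBranching_four (by grind) (by grind) (by grind) (by grind) (by grind) (by grind)
        ab bc cd,
      by simp [*, Ne.symm]⟩
  · exact ⟨_, _, a, c,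
      isInBranching_four (by grind) (by grind) (by grind) (by grind) (by grind) (by grind)
        ca bc db,
      isOutBranching_four (by grind) (by grind) (by grind) (by grind) (by grind) (by grind)
        cd da ab,
      by simp [*, Ne.symm]⟩

omit [Fintype V] [DecidableEq V] in
/-- Any three vertices of a semicomplete digraph can be ordered into a directed path. -/
theorem SemicompleteOn.exists_path_three {S : Finset V} {A : Finset (V × V)}
    (hsc : SemicompleteOn S A) (hS : 3 ≤ S.card) :
    ∃ x ∈ S, ∃ y ∈ S, ∃ z ∈ S, x ≠ y ∧ x ≠ z ∧ y ≠ z ∧ (x, y) ∈ A ∧ (y, z) ∈ A := by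
  obtain ⟨x, hx, y, hy, z, hz, hxy, hxz, hyz⟩ := Finset.two_lt_card.mp hS
  rcases hsc x hx y hy hxy with h | h <;> rcases hsc x hx z hz hxz with h' | h' <;>
    rcases hsc y hy z hz hyz with h'' | h'' <;> grind

omit [Fintype V] in
/-- Every semicomplete digraph on exactly four vertices has a Hamiltonian path. -/
theorem SemicompleteOn.exists_path_four {S : Finset V} {A : Finset (V × V)}
    (hsc : SemicompleteOn S A) (hS : S.card = 4) :
    ∃ a b c d, S = {a, b, c, d} ∧ a ≠ b ∧ a ≠ c ∧ a ≠ d ∧ b ≠ c ∧ b ≠ d ∧ c ≠ d ∧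
      (a, b) ∈ A ∧ (b, c) ∈ A ∧ (c, d) ∈ A := by
  obtain ⟨x, hx, y, hy, z, hz, hxy, hxz, hyz, axy, ayz⟩ := hsc.exists_path_three (by omega)
  have hcard : ({x, y, z} : Finset V).card = 3 := Finset.card_eq_three.mpr
    ⟨x, y, z, hxy, hxz, hyz, rfl⟩
  have hsub : ({x, y, z} : Finset V) ⊆ S := by
    simp [Finset.insert_subset_iff, hx, hy, hz]
  obtain ⟨w, hw⟩ := Finset.card_eq_one.mp
    (show (S \ {x, y, z}).card = 1 by rw [Finset.card_sdiff_of_subset hsub]; omega)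
  have hwmem : w ∈ S \ {x, y, z} := hw ▸ Finset.mem_singleton_self w
  simp only [Finset.mem_sdiff, Finset.mem_insert, Finset.mem_singleton, not_or] at hwmem
  obtain ⟨hwS, hwx, hwy, hwz⟩ := hwmem
  have hSeq : S = {w, x, y, z} := by
    rw [← Finset.sdiff_union_of_subset hsub, hw]
    rfl
  rcases hsc w hwS x hx hwx with h | h
  · exact ⟨w, x, y, z, hSeq, hwx, hwy, hwz, hxy, hxz, hyz, h, axy, ayz⟩
  rcases hsc w hwS y hy hwy with h' | h'
  · exact ⟨x, w, y, z, by grind, Ne.symm hwx, hxy, hxz, hwy, hwz, hyz, h, h', ayz⟩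
  rcases hsc w hwS z hz hwz with h'' | h''
  · exact ⟨x, y, w, z, by grind, hxy, Ne.symm hwx, hxz, Ne.symm hwy, hyz, hwz, axy, h', h''⟩
  · exact ⟨x, y, z, w, by grind, hxy, hxz, Ne.symm hwx, hyz, Ne.symm hwy, Ne.symm hwz, axy, ayz,
      h''⟩

omit [Fintype V] [DecidableEq V] in
theorem SemicompleteOn.mono {S T : Finset V} {A : Finset (V × V)}
    (hsc : SemicompleteOn S A) (hTS : T ⊆ S) : SemicompleteOn T A :=
  fun u hu v hv huv => hsc u (hTS hu) v (hTS hv) huv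

omit [Fintype V] in
theorem SemicompleteOn.goodPair {A : Finset (V × V)} {S : Finset V}
    (hsc : SemicompleteOn S A) (hS : 4 ≤ S.card) : GoodPair S A := by
  obtain ⟨n, hn⟩ : ∃ n, S.card = n := ⟨_, rfl⟩
  rw [hn] at hS
  induction n, hS using Nat.le_induction generalizing S with
  | base =>
    obtain ⟨a, b, c, d, rfl, hab, hac, had, hbc, hbd, hcd, ab, bc, cd⟩ :=
      hsc.exists_path_four hn
    exact goodPair_of_hamiltonian_path hab hac had hbc hbd hcd hsc ab bc cd
  | succ n hle ih =>
    obtain ⟨u, hu, v, hv, w, hw, huv, -, hvw, auv, avw⟩ :=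
      hsc.exists_path_three (by omega)
    rw [← Finset.insert_erase hv]
    refine (ih (hsc.mono (Finset.erase_subset v S)) ?_).insert
      (Finset.mem_erase.mpr ⟨huv, hu⟩) (Finset.mem_erase.mpr ⟨hvw.symm, hw⟩)
      (Finset.notMem_erase v S) auv avw
    rw [Finset.card_erase_of_mem hv, hn]
    rfl

/-- Every semicomplete digraph on at least 4 vertices has a good pair. -/
theorem stmt2 {V : Type*} [Fintype V] [DecidableEq V]
    (A : Finset (V × V)) (hirr : ∀ e ∈ A, e.1 ≠ e.2)
    (hcard : 4 ≤ Fintype.card V) (hsc : SemicompleteOn Finset.univ A) :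
    GoodPair Finset.univ A :=
  hsc.goodPair hcard
end

section
/- Let D be a digraph on exactly 4 vertices with at least 6 arcs and minimum semidegree δ⁰(D) ≥ 1. Then D has a good pair if and only if D is not isomorphic to the digraph E₄, where E₄ has vertices x, y, x', y' and arc set {x→y, y→x, x'→y', y'→x', x→y', x'→y}. -/
/-!
Digraphs are modelled by a finite vertex type `V` (with decidable equality) together with
an arc set `A : Finset (V × V)`; irreflexivity (`∀ e ∈ A, e.1 ≠ e.2`) is stated as a
hypothesis.  Subdigraphs on a vertex set `S : Finset V` use arcs with both endpoints in `S`.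
-/

variable {V : Type*} [Fintype V] [DecidableEq V]

theorem Reach.exists_crossing {W : Type*} {B : Finset (W × W)} {q v : W} (h : Reach B q v)
    (X : Set W) (hq : q ∈ X) (hv : v ∉ X) : ∃ e ∈ B, e.1 ∈ X ∧ e.2 ∉ X := by
  induction h with
  | refl => exact absurd hq hv
  | @tail b c _ hbc ih =>
    by_cases hb : b ∈ X
    · exact ⟨(b, c), hbc, hb, hv⟩
    · exact ih hb

/-- The arcs of the tree obtained from `a` by hanging `b` on `a`, `c` on `i` and `d` on `j`. -/
def treeArcs {W : Type*} (a b c d i j : W) : List (W × W) := [(a, b), (i, c), (j, d)]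

/-- The vertices `a, b, c, d` are distinct and each is hung on an earlier one. -/
def IsGrowth {W : Type*} (a b c d i j : W) : Prop :=
  [a, b, c, d].Nodup ∧ (i = a ∨ i = b) ∧ (j = a ∨ j = b ∨ j = c)

theorem IsGrowth.map {W W' : Type*} {a b c d i j : W} (h : IsGrowth a b c d i j) (f : W ↪ W') :
    IsGrowth (f a) (f b) (f c) (f d) (f i) (f j) := by
  simpa [IsGrowth, f.injective.eq_iff] using h

theorem IsGrowth.isOutBranching {A : Finset (V × V)} {a b c d i j : V}
    (h : IsGrowth a b c d i j) (huniv : ∀ v, v = a ∨ v = b ∨ v = c ∨ v = d)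
    (hA : ∀ e ∈ treeArcs a b c d i j, e ∈ A) :
    IsOutBranching Finset.univ A (treeArcs a b c d i j).toFinset a := by
  obtain ⟨hnd, hi, hj⟩ := h
  simp only [List.nodup_cons, List.mem_cons, List.not_mem_nil, or_false, not_or] at hnd
  obtain ⟨⟨hab, hac, had⟩, ⟨hbc, hbd⟩, hcd, -⟩ := hnd
  set B := (treeArcs a b c d i j).toFinset with hB
  have ra : Reach B a a := Relation.ReflTransGen.refl
  have rb : Reach B a b := ra.tail (by simp [hB, treeArcs])
  have rc : Reach B a c := by
    have ri : Reach B a i := by rcases hi with rfl | rfl <;> assumption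
    exact ri.tail (by simp [hB, treeArcs])
  have rd : Reach B a d := by
    have rj : Reach B a j := by rcases hj with rfl | rfl | rfl <;> assumption
    exact rj.tail (by simp [hB, treeArcs])
  refine ⟨Finset.mem_univ _, fun e he => hA e (List.mem_toFinset.1 he), by simp, ?_, ?_⟩
  · intro v _
    rcases huniv v with rfl | rfl | rfl | rfl <;> assumption
  · intro v _ hv
    rw [Finset.card_eq_one]
    rcases huniv v with rfl | rfl | rfl | rfl
    · exact absurd rfl hv
    · exact ⟨(a, v), by ext ⟨s, t⟩; simp [hB, treeArcs]; grind⟩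
    · exact ⟨(i, v), by ext ⟨s, t⟩; simp [hB, treeArcs]; grind⟩
    · exact ⟨(j, v), by ext ⟨s, t⟩; simp [hB, treeArcs]; grind⟩

theorem reach_image_swap {W : Type*} [DecidableEq W] {B : Finset (W × W)} {u v : W} (h : Reach B u v) :
    Reach (B.image Prod.swap) v u := by
  induction h with
  | refl => exact Relation.ReflTransGen.refl
  | @tail b c _ hbc ih =>
    exact Relation.ReflTransGen.head (Finset.mem_image.2 ⟨(b, c), hbc, rfl⟩) ih

theorem IsOutBranching.image_swap {W : Type*} [DecidableEq W] {S : Finset W}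
    {A B : Finset (W × W)} {q : W}
    (h : IsOutBranching S A B q) :
    IsInBranching S (A.image Prod.swap) (B.image Prod.swap) q := by
  obtain ⟨hq, hBA, hS, hr, hd⟩ := h
  refine ⟨hq, Finset.image_subset_image hBA, ?_, fun v hv => reach_image_swap (hr v hv), ?_⟩
  · simp only [Finset.mem_image]
    rintro _ ⟨e, he, rfl⟩
    exact (hS e he).symm
  · intro v hv hvq
    rw [Finset.filter_image, Finset.card_image_of_injective _ Prod.swap_injective]
    exact hd v hv hvq

theorem IsGrowth.isInBranching {A : Finset (V × V)} {a b c d i j : V}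
    (h : IsGrowth a b c d i j) (huniv : ∀ v, v = a ∨ v = b ∨ v = c ∨ v = d)
    (hA : ∀ e ∈ treeArcs a b c d i j, e.swap ∈ A) :
    IsInBranching Finset.univ A ((treeArcs a b c d i j).toFinset.image Prod.swap) a := by
  have := (h.isOutBranching (A := A.image Prod.swap) huniv
    fun e he => Finset.mem_image.2 ⟨_, hA e he, Prod.swap_swap e⟩).image_swap
  simpa [Finset.image_image] using this

/-- An injective numbering of the arcs of the complete digraph on `Fin 4` by `0, …, 11`. -/
def arcCode (e : Fin 4 × Fin 4) : ℕ := 3 * e.1.val + e.2.val - (Nat.ble e.1.val e.2.val).toNat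

/-- The bit mask of a list of arcs. -/
def arcMask (l : List (Fin 4 × Fin 4)) : ℕ := l.foldr (fun e m => 1 <<< arcCode e ||| m) 0

theorem arcCode_lt : ∀ e : Fin 4 × Fin 4, e.1 ≠ e.2 → arcCode e < 12 := by decide

theorem arcCode_inj : ∀ e f : Fin 4 × Fin 4, e.1 ≠ e.2 → f.1 ≠ f.2 →
    arcCode e = arcCode f → e = f := by decide +kernel

theorem testBit_arcMask {l : List (Fin 4 × Fin 4)} (hl : ∀ e ∈ l, e.1 ≠ e.2)
    {e : Fin 4 × Fin 4} (he : e.1 ≠ e.2) : (arcMask l).testBit (arcCode e) ↔ e ∈ l := by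
  induction l with
  | nil => simp [arcMask]
  | cons f l ih =>
    have hf := hl f List.mem_cons_self
    have ih' := ih fun g hg => hl g (List.mem_cons_of_mem _ hg)
    have hc : arcCode f = arcCode e ↔ e = f :=
      ⟨fun h => (arcCode_inj f e hf he h).symm, fun h => h ▸ rfl⟩
    have : arcMask (f :: l) = 1 <<< arcCode f ||| arcMask l := rfl
    rw [this, Nat.testBit_or, Nat.one_shiftLeft, Nat.testBit_two_pow, Bool.or_eq_true, ih',
      decide_eq_true_iff, hc, List.mem_cons]

theorem arcMask_lt {l : List (Fin 4 × Fin 4)} (hl : ∀ e ∈ l, e.1 ≠ e.2) :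
    arcMask l < 2 ^ 12 := by
  induction l with
  | nil => simp [arcMask]
  | cons f l ih =>
    refine Nat.or_lt_two_pow ?_ (ih fun g hg => hl g (List.mem_cons_of_mem _ hg))
    rw [Nat.one_shiftLeft]
    exact Nat.pow_lt_pow_right (by norm_num) (arcCode_lt f (hl f List.mem_cons_self))

theorem IsGrowth.treeArcs_ne {W : Type*} {a b c d i j : W} (h : IsGrowth a b c d i j) :
    ∀ e ∈ treeArcs a b c d i j, e.1 ≠ e.2 := by
  obtain ⟨hnd, hi, hj⟩ := h
  simp only [List.nodup_cons, List.mem_cons, List.not_mem_nil, or_false, not_or] at hnd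
  simp only [treeArcs, List.mem_cons, List.not_mem_nil, or_false]
  grind

theorem IsGrowth.map_exhausts {W : Type*} {a b c d i j : Fin 4} (h : IsGrowth a b c d i j)
    (f : Fin 4 ≃ W) (v : W) : v = f a ∨ v = f b ∨ v = f c ∨ v = f d := by
  obtain ⟨k, rfl⟩ := f.surjective v
  have hnd := h.1
  simp only [List.nodup_cons, List.mem_cons, List.not_mem_nil, or_false, not_or] at hnd
  simp only [f.injective.eq_iff]
  omega

/-- Codes of the spanning out-trees on `Fin 4`. -/
def outMasks : List ℕ :=
  [7, 14, 21, 28, 35, 42, 49, 56, 69, 84, 97, 112, 134, 140, 162, 168, 196, 224, 259, 266, 273,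
   280, 321, 336, 386, 392, 448, 515, 529, 546, 560, 642, 672, 769, 784, 896, 1030, 1034, 1044,
   1048, 1092, 1104, 1282, 1288, 1344, 1538, 1552, 1792, 2053, 2060, 2081, 2088, 2113, 2144,
   2180, 2184, 2240, 2561, 2592, 2688, 3076, 3080, 3136, 3584]

/-- Codes of the spanning in-trees on `Fin 4`. -/
def inMasks : List ℕ :=
  [76, 84, 97, 100, 140, 161, 162, 164, 266, 268, 273, 274, 276, 289, 290, 292, 522, 529, 530,
   546, 577, 584, 592, 608, 641, 642, 648, 672, 769, 776, 784, 800, 1034, 1041, 1042, 1044,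
   1089, 1092, 1096, 1104, 1153, 1154, 1156, 1160, 1281, 1282, 1284, 1288, 2058, 2060, 2065,
   2066, 2068, 2081, 2082, 2084, 2113, 2120, 2128, 2144, 2177, 2178, 2180, 2184]

/-- Codes of the copies of `E₄` on `Fin 4`. -/
def exceptionalMasks : List ℕ :=
  [694, 917, 1142, 1386, 1748, 1762, 2409, 2445, 2716, 2841, 3171, 3339]

theorem exists_growth_of_mem_outMasks : ∀ p ∈ outMasks, ∃ a b c d : Fin 4, [a, b, c, d].Nodup ∧
    ∃ i, (i = a ∨ i = b) ∧ ∃ j, (j = a ∨ j = b ∨ j = c) ∧ arcMask (treeArcs a b c d i j) = p := by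
  decide +kernel

theorem exists_growth_of_mem_inMasks : ∀ p ∈ inMasks, ∃ a b c d : Fin 4, [a, b, c, d].Nodup ∧
    ∃ i, (i = a ∨ i = b) ∧ ∃ j, (j = a ∨ j = b ∨ j = c) ∧ arcMask ((treeArcs a b c d i j).map Prod.swap) = p := by
  decide +kernel

theorem exists_of_mem_exceptionalMasks : ∀ p ∈ exceptionalMasks, ∃ x y x' y' : Fin 4,
    [x, y, x', y'].Nodup ∧
      arcMask [(x, y), (y, x), (x', y'), (y', x'), (x, y'), (x', y)] = p := by
  decide +kernel

/-- Codes of the sets of arcs leaving a vertex, and of the sets of arcs entering a vertex. -/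
def starMasks : List ℕ := [7, 56, 448, 3584, 584, 1153, 2066, 292]

theorem exists_vertex_of_mem_starMasks : ∀ s ∈ starMasks, ∃ u : Fin 4,
    (∀ v, u ≠ v → s.testBit (arcCode (u, v))) ∨ (∀ v, v ≠ u → s.testBit (arcCode (v, u))) := by
  decide +kernel

/-- Every vertex has an out-neighbour and an in-neighbour in the digraph coded by `m`. -/
def hasMinDegrees (m : ℕ) : Bool :=
  starMasks.all fun s => !(Nat.land s m).beq 0

/-- The digraph coded by `m` has an arc-disjoint pair of a spanning out-tree and in-tree. -/
def hasDisjointTrees (m : ℕ) : Bool :=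
  outMasks.any fun o => (Nat.land o m).beq o &&
    inMasks.any fun i => (Nat.land i m).beq i && (Nat.land o i).beq 0

/-- The verification carried out for the digraph coded by `m`. -/
def checkMask (m : ℕ) : Bool :=
  !hasMinDegrees m || (List.range 12).countP m.testBit < 6 || hasDisjointTrees m ||
    exceptionalMasks.elem m

theorem checkMask_block : ∀ i < 64, ∀ j < 64, checkMask (64 * i + j) = true := by
  decide +kernel

theorem checkMask_of_lt {m : ℕ} (hm : m < 2 ^ 12) : checkMask m = true := by
  have := checkMask_block (m / 64) (by omega) (m % 64) (by omega)
  rwa [Nat.div_add_mod] at this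

theorem not_goodPair_of_exceptional {x y x' y' : V} (h : [x, y, x', y'].Nodup) :
    ¬ GoodPair Finset.univ
      ({(x, y), (y, x), (x', y'), (y', x'), (x, y'), (x', y)} : Finset (V × V)) := by
  rintro ⟨I, O, r, q, ⟨-, hI, -, hr, -⟩, ⟨-, hO, -, hq, -⟩, hdisj⟩
  have cutO (X : Set V) (v : V) (h1 : q ∈ X) (h2 : v ∉ X) :=
    (hq v (Finset.mem_univ v)).exists_crossing X h1 h2
  have cutI (X : Set V) (v : V) (h1 : v ∈ X) (h2 : r ∉ X) :=
    (hr v (Finset.mem_univ v)).exists_crossing X h1 h2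
  have hdisj' : ∀ e, e ∈ I → e ∉ O := fun _ he => Finset.disjoint_left.1 hdisj he
  simp only [List.nodup_cons, List.mem_cons, List.not_mem_nil, or_false, not_or] at h
  obtain ⟨⟨hxy, hxx', hxy'⟩, ⟨hyx', hyy'⟩, hxy₂, -⟩ := h
  have memI (e) (he : e ∈ I) := hI he
  have memO (e) (he : e ∈ O) := hO he
  simp only [Finset.mem_insert, Finset.mem_singleton] at memI memO
  have Oyx : q = x ∨ (y, x) ∈ O := by
    by_contra! hc
    obtain ⟨⟨s, t⟩, he, h1, h2⟩ := cutO {x}ᶜ x (by simpa using hc.1) (by simp)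
    have := memO _ he
    simp at h1 h2
    clear hI hO hq hr hdisj cutO cutI
    grind
  have Oyx' : q = x' ∨ (y', x') ∈ O := by
    by_contra! hc
    obtain ⟨⟨s, t⟩, he, h1, h2⟩ := cutO {x'}ᶜ x' (by simpa using hc.1) (by simp)
    have := memO _ he
    simp at h1 h2
    clear hI hO hq hr hdisj cutO cutI
    grind
  have Iyx : r = y ∨ (y, x) ∈ I := by
    by_contra! hc
    obtain ⟨⟨s, t⟩, he, h1, h2⟩ := cutI {y} y (by simp) (by simpa using hc.1)
    have := memI _ he
    simp at h1 h2
    clear hI hO hq hr hdisj cutO cutI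
    grind
  have Iyx' : r = y' ∨ (y', x') ∈ I := by
    by_contra! hc
    obtain ⟨⟨s, t⟩, he, h1, h2⟩ := cutI {y'} y' (by simp) (by simpa using hc.1)
    have := memI _ he
    simp at h1 h2
    clear hI hO hq hr hdisj cutO cutI
    grind
  have key : q = x' ∧ r = y ∨ q = x ∧ r = y' := by grind
  rcases key with ⟨rfl, rfl⟩ | ⟨rfl, rfl⟩
  · obtain ⟨⟨s, t⟩, he, h1, h2⟩ := cutO {q, y'} x (by simp) (by simp [*])
    obtain ⟨⟨s', t'⟩, he', h1', h2'⟩ := cutI {q, y'} q (by simp) (by simp [*])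
    have := memO _ he
    have := memI _ he'
    simp at h1 h2 h1' h2'
    clear hI hO hq hr hdisj cutO cutI
    grind (splits := 20)
  · obtain ⟨⟨s, t⟩, he, h1, h2⟩ := cutO {q, y} x' (by simp) (by simp; grind)
    obtain ⟨⟨s', t'⟩, he', h1', h2'⟩ := cutI {q, y} q (by simp) (by simp; grind)
    have := memO _ he
    have := memI _ he'
    simp at h1 h2 h1' h2'
    clear hI hO hq hr hdisj cutO cutI
    grind (splits := 20)

/-- A digraph on exactly 4 vertices with at least 6 arcs and minimum
semidegree at least 1 has a good pair iff it is not isomorphic to `E₄`. -/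
theorem stmt9 {V : Type*} [Fintype V] [DecidableEq V]
    (A : Finset (V × V)) (hirr : ∀ e ∈ A, e.1 ≠ e.2)
    (hcard : Fintype.card V = 4) (harcs : 6 ≤ A.card)
    (hdeg : MinSemidegreeGE A 1) :
    GoodPair Finset.univ A ↔
      ¬ ∃ x y x' y' : V,
          x ≠ y ∧ x ≠ x' ∧ x ≠ y' ∧ y ≠ x' ∧ y ≠ y' ∧ x' ≠ y' ∧
          A = ({(x, y), (y, x), (x', y'), (y', x'), (x, y'), (x', y)} : Finset (V × V)) := by
  classical
  constructor
  · rintro hgood ⟨x, y, x', y', h1, h2, h3, h4, h5, h6, rfl⟩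
    exact not_goodPair_of_exceptional (by simp [*]) hgood
  intro hE
  let f : Fin 4 ≃ V := (Fintype.equivFinOfCardEq hcard).symm
  let F : Fin 4 × Fin 4 ≃ V × V := f.prodCongr f
  let L := (A.map F.symm.toEmbedding).toList
  have hmemL (e : Fin 4 × Fin 4) : e ∈ L ↔ F e ∈ A := by
    simp [L, Finset.mem_map_equiv]
  have hL : ∀ e ∈ L, e.1 ≠ e.2 := fun e he h =>
    hirr _ ((hmemL e).1 he) (congrArg f h)
  have hbit {e : Fin 4 × Fin 4} (he : e.1 ≠ e.2) :
      (arcMask L).testBit (arcCode e) ↔ F e ∈ A :=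
    (testBit_arcMask hL he).trans (hmemL e)
  have hsub {l : List (Fin 4 × Fin 4)} (hl : ∀ e ∈ l, e.1 ≠ e.2)
      (h : arcMask l &&& arcMask L = arcMask l) : ∀ e ∈ l, F e ∈ A := by
    intro e he
    have := (testBit_arcMask hl (hl e he)).2 he
    rw [← h, Nat.testBit_and, Bool.and_eq_true] at this
    exact (hbit (hl e he)).1 this.2
  have hcheck := checkMask_of_lt (arcMask_lt hL)
  simp only [checkMask, Bool.or_eq_true, decide_eq_true_eq, Bool.not_eq_true', or_assoc] at hcheck
  rcases hcheck with h | h | h | h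
  · exfalso
    refine absurd ?_ (Bool.eq_false_iff.1 h)
    simp only [hasMinDegrees, List.all_eq_true, Bool.not_eq_true', ← Bool.not_eq_true]
    intro s hs h0
    have hno {k : ℕ} (h1 : s.testBit k) (h2 : (arcMask L).testBit k) : False := by
      have : (s &&& arcMask L).testBit k = false := by rw [show s &&& arcMask L = 0 from Nat.eq_of_beq_eq_true h0]; simp
      simp [Nat.testBit_and, h1, h2] at this
    obtain ⟨u, hu | hu⟩ := exists_vertex_of_mem_starMasks s hs
    · obtain ⟨⟨s', t⟩, hst⟩ := Finset.card_pos.1 (hdeg (f u)).2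
      obtain ⟨hst, rfl⟩ := Finset.mem_filter.1 hst
      have hne : u ≠ f.symm t := fun h => hirr _ hst (by simp [h])
      exact hno (hu _ hne) ((hbit (e := (u, f.symm t)) hne).2 (by simpa [F] using hst))
    · obtain ⟨⟨s', t⟩, hst⟩ := Finset.card_pos.1 (hdeg (f u)).1
      obtain ⟨hst, rfl⟩ := Finset.mem_filter.1 hst
      have hne : f.symm s' ≠ u := fun h => hirr _ hst (by simp [← h])
      exact hno (hu _ hne) ((hbit (e := (f.symm s', u)) hne).2 (by simpa [F] using hst))
  · exfalso
    have hle : A.card ≤ ((Finset.range 12).filter fun k => (arcMask L).testBit k).card := by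
      refine Finset.card_le_card_of_injOn (fun e => arcCode (F.symm e)) ?_ ?_
      · intro e he
        have hne : (F.symm e).1 ≠ (F.symm e).2 := hL _ ((hmemL _).2 (by simpa using he))
        have hb := (hbit hne).2 (by simpa using he)
        simpa using ⟨arcCode_lt _ hne, hb⟩
      · intro e he e' he' h
        exact F.symm.injective (arcCode_inj _ _ (hL _ ((hmemL _).2 (by simpa using he)))
          (hL _ ((hmemL _).2 (by simpa using he'))) h)
    have heq : ((Finset.range 12).filter fun k => (arcMask L).testBit k).card =
        (List.range 12).countP (arcMask L).testBit := by
      rw [List.countP_eq_length_filter, ← List.toFinset_range, ← List.toFinset_filter,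
        List.toFinset_card_of_nodup (List.nodup_range.filter _)]
    omega
  · simp only [hasDisjointTrees, List.any_eq_true, Bool.and_eq_true] at h
    obtain ⟨o, ho, hoL, i, hi, hiL, hoi⟩ := h
    obtain ⟨a, b, c, d, hnd, s, hs, t, ht, rfl⟩ := exists_growth_of_mem_outMasks o ho
    have hg : IsGrowth a b c d s t := ⟨hnd, hs, ht⟩
    obtain ⟨a', b', c', d', hnd', s', hs', t', ht', rfl⟩ := exists_growth_of_mem_inMasks i hi
    have hg' : IsGrowth a' b' c' d' s' t' := ⟨hnd', hs', ht'⟩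
    have hlo := hg.treeArcs_ne
    have hli : ∀ e ∈ (treeArcs a' b' c' d' s' t').map Prod.swap, e.1 ≠ e.2 := by
      intro e he
      obtain ⟨e', he', rfl⟩ := List.mem_map.1 he
      exact (hg'.treeArcs_ne e' he').symm
    have hmap (a b c d s t : Fin 4) : treeArcs (f a) (f b) (f c) (f d) (f s) (f t) =
        (treeArcs a b c d s t).map F := rfl
    refine ⟨_, _, _, _, (hg'.map f.toEmbedding).isInBranching (hg'.map_exhausts f) ?_,
      (hg.map f.toEmbedding).isOutBranching (hg.map_exhausts f) ?_, ?_⟩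
    · intro e he
      obtain ⟨e', he', rfl⟩ := List.mem_map.1 (hmap a' b' c' d' s' t' ▸ he)
      exact hsub hli (Nat.eq_of_beq_eq_true hiL) e'.swap (List.mem_map_of_mem he')
    · intro e he
      obtain ⟨e', he', rfl⟩ := List.mem_map.1 (hmap a b c d s t ▸ he)
      exact hsub hlo (Nat.eq_of_beq_eq_true hoL) e' he'
    · rw [Finset.disjoint_left]
      intro e he1 he2
      simp only [Finset.mem_image, List.mem_toFinset] at he1 he2
      obtain ⟨e1, he1, rfl⟩ := he1
      obtain ⟨e', he', rfl⟩ := List.mem_map.1 (hmap a' b' c' d' s' t' ▸ he1)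
      obtain ⟨e'', he'', h⟩ := List.mem_map.1 (hmap a b c d s t ▸ he2)
      have h' : e'' = e'.swap := F.injective h
      subst h'
      have b1 := (testBit_arcMask hlo (hlo _ he'')).2 he''
      have b2 := (testBit_arcMask hli (hlo _ he'')).2 (List.mem_map_of_mem he')
      have := congrArg (Nat.testBit · (arcCode e'.swap)) (show _ &&& _ = 0 from Nat.eq_of_beq_eq_true hoi)
      simp [Nat.testBit_and, b1, b2] at this
  · refine absurd ?_ hE
    obtain ⟨x, y, x', y', hnd, hm⟩ :=
      exists_of_mem_exceptionalMasks _ (List.elem_iff.1 h)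
    have hnd' := hnd
    simp only [List.nodup_cons, List.mem_cons, List.not_mem_nil, or_false, not_or] at hnd'
    obtain ⟨⟨h1, h2, h3⟩, ⟨h4, h5⟩, h6, -⟩ := hnd'
    refine ⟨f x, f y, f x', f y', f.injective.ne h1, f.injective.ne h2, f.injective.ne h3,
      f.injective.ne h4, f.injective.ne h5, f.injective.ne h6, ?_⟩
    have hl : ∀ e ∈ [(x, y), (y, x), (x', y'), (y', x'), (x, y'), (x', y)], e.1 ≠ e.2 := by
      simp [*, Ne.symm h1, Ne.symm h4, Ne.symm h6]
    ext e
    obtain ⟨⟨s, t⟩, rfl⟩ := F.surjective e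
    have hmem : F (s, t) ∈ A ↔
        (s, t) ∈ [(x, y), (y, x), (x', y'), (y', x'), (x, y'), (x', y)] := by
      by_cases hst : s = t
      · exact ⟨fun h => absurd (congrArg f hst) (hirr _ h), fun h => absurd hst (hl _ h)⟩
      · rw [← hbit (e := (s, t)) hst, ← hm, testBit_arcMask hl hst]
    rw [hmem]
    simp [F]
end

section
/- Let R be a natural number. If there exists a digraph H with arc-connectivity λ(H) = R and two (possibly equal) vertices s, t of H such that H has no pair of arc-disjoint branchings consisting of an out-branching rooted at s and an in-branching rooted at t, then there exists a digraph U with λ(U) = R which has no good pair. -/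
/-!
Digraphs are modelled by a finite vertex type `V` (with decidable equality) together with
an arc set `A : Finset (V × V)`; irreflexivity (`∀ e ∈ A, e.1 ≠ e.2`) is stated as a
hypothesis.  Subdigraphs on a vertex set `S : Finset V` use arcs with both endpoints in `S`.
-/

variable {V : Type*} [Fintype V] [DecidableEq V]

section Copies

set_option linter.unusedSectionVars false

variable {W K : Type*} [Fintype W] [DecidableEq W] [Fintype K] [DecidableEq K]

/-- Copies of the digraph with arc set `A`, indexed by `K`, on the vertex type `W ≃ K × V`.
The vertex `t` of copy `i` dominates the vertex `s` of every other copy except copy `σ i`. -/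
def copies (A : Finset (V × V)) (s t : V) (σ : K → K) (f : W ≃ K × V) : Finset (W × W) :=
  Finset.univ.filter fun e =>
    ((f e.1).1 = (f e.2).1 ∧ ((f e.1).2, (f e.2).2) ∈ A) ∨
    ((f e.1).1 ≠ (f e.2).1 ∧ (f e.2).1 ≠ σ (f e.1).1 ∧ (f e.1).2 = t ∧ (f e.2).2 = s)

/-- The arcs of `B` lying inside copy `i`. -/
def inCopy (f : W ≃ K × V) (i : K) (B : Finset (W × W)) : Finset (V × V) :=
  Finset.univ.filter fun e => (f.symm (i, e.1), f.symm (i, e.2)) ∈ B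

variable {A : Finset (V × V)} {s t : V} {σ : K → K} {f : W ≃ K × V}

theorem symm_mk_snd {w : W} {i : K} (h : (f w).1 = i) : f.symm (i, (f w).2) = w := by
  rw [← h, Prod.mk.eta, Equiv.symm_apply_apply]

theorem mem_copies {a b : W} :
    (a, b) ∈ copies A s t σ f ↔
      ((f a).1 = (f b).1 ∧ ((f a).2, (f b).2) ∈ A) ∨
      ((f a).1 ≠ (f b).1 ∧ (f b).1 ≠ σ (f a).1 ∧ (f a).2 = t ∧ (f b).2 = s) := by
  simp [copies]

theorem mem_inCopy {i : K} {B : Finset (W × W)} {u v : V} :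
    (u, v) ∈ inCopy f i B ↔ (f.symm (i, u), f.symm (i, v)) ∈ B := by
  simp [inCopy]

theorem inCopy_subset {i : K} {B : Finset (W × W)} (hB : B ⊆ copies A s t σ f) :
    inCopy f i B ⊆ A := by
  rintro ⟨u, v⟩ h
  simpa [mem_copies] using hB (mem_inCopy.1 h)

theorem disjoint_inCopy {i : K} {B C : Finset (W × W)} (h : Disjoint B C) :
    Disjoint (inCopy f i B) (inCopy f i C) := by
  rw [Finset.disjoint_left] at h ⊢
  rintro ⟨u, v⟩ hB hC
  exact h (mem_inCopy.1 hB) (mem_inCopy.1 hC)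

theorem IsOutBranching.inCopy {O : Finset (W × W)} {q : W} {i : K}
    (hO : IsOutBranching Finset.univ (copies A s t σ f) O q) (hi : (f q).1 ≠ i) :
    IsOutBranching Finset.univ A (inCopy f i O) s := by
  obtain ⟨-, hsub, -, hreach, hdeg⟩ := hO
  refine ⟨Finset.mem_univ _, inCopy_subset hsub, by simp, fun v _ => ?_, fun v _ hv => ?_⟩
  · have key : ∀ w, Reach O q w → (f w).1 = i → Reach (_root_.inCopy f i O) s (f w).2 := by
      intro w hw
      induction hw with
      | refl => exact fun h => absurd h hi
      | @tail b c _ hbc ih =>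
        intro hc
        rcases mem_copies.1 (hsub hbc) with ⟨h, -⟩ | ⟨-, -, -, h⟩
        · have hb := h.trans hc
          refine (ih hb).tail (mem_inCopy.2 ?_)
          rwa [symm_mk_snd hb, symm_mk_snd hc]
        · rw [h]
          exact Relation.ReflTransGen.refl
    simpa using key _ (hreach (f.symm (i, v)) (Finset.mem_univ _)) (by simp)
  · rw [← hdeg (f.symm (i, v)) (Finset.mem_univ _) (by rintro rfl; simp at hi)]
    refine Finset.card_bij (fun e _ => (f.symm (i, e.1), f.symm (i, e.2))) ?_ ?_ ?_
    · rintro ⟨a, b⟩ h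
      simpa [mem_inCopy] using h
    · rintro ⟨a, b⟩ - ⟨c, d⟩ - h
      simpa using h
    · rintro ⟨a, b⟩ h
      obtain ⟨hab, rfl⟩ : (a, b) ∈ O ∧ b = f.symm (i, v) := by simpa using h
      rcases mem_copies.1 (hsub hab) with ⟨h, -⟩ | ⟨-, -, -, h⟩
      · have ha : f.symm (i, (f a).2) = a := symm_mk_snd (by simpa using h)
        exact ⟨((f a).2, v), by simpa [mem_inCopy, ha] using hab, by simp [ha]⟩
      · exact absurd (by simpa using h) hv

theorem IsInBranching.inCopy {I : Finset (W × W)} {r : W} {i : K}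
    (hI : IsInBranching Finset.univ (copies A s t σ f) I r) (hi : (f r).1 ≠ i) :
    IsInBranching Finset.univ A (inCopy f i I) t := by
  obtain ⟨-, hsub, -, hreach, hdeg⟩ := hI
  refine ⟨Finset.mem_univ _, inCopy_subset hsub, by simp, fun v _ => ?_, fun v _ hv => ?_⟩
  · have key : ∀ w, Reach I w r → (f w).1 = i → Reach (_root_.inCopy f i I) (f w).2 t := by
      intro w hw
      induction hw using Relation.ReflTransGen.head_induction_on with
      | refl => exact fun h => absurd h hi
      | @head b c hbc _ ih =>
        intro hb
        rcases mem_copies.1 (hsub hbc) with ⟨h, -⟩ | ⟨-, -, h, -⟩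
        · have hc := h.symm.trans hb
          refine (ih hc).head (mem_inCopy.2 ?_)
          rwa [symm_mk_snd hb, symm_mk_snd hc]
        · rw [h]
          exact Relation.ReflTransGen.refl
    simpa using key _ (hreach (f.symm (i, v)) (Finset.mem_univ _)) (by simp)
  · rw [← hdeg (f.symm (i, v)) (Finset.mem_univ _) (by rintro rfl; simp at hi)]
    refine Finset.card_bij (fun e _ => (f.symm (i, e.1), f.symm (i, e.2))) ?_ ?_ ?_
    · rintro ⟨a, b⟩ h
      simpa [mem_inCopy] using h
    · rintro ⟨a, b⟩ - ⟨c, d⟩ - h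
      simpa using h
    · rintro ⟨a, b⟩ h
      obtain ⟨hab, rfl⟩ : (a, b) ∈ I ∧ a = f.symm (i, v) := by simpa using h
      rcases mem_copies.1 (hsub hab) with ⟨h, -⟩ | ⟨-, -, h, -⟩
      · have hb : f.symm (i, (f b).2) = b := symm_mk_snd (by simpa using h.symm)
        exact ⟨(v, (f b).2), by simpa [mem_inCopy, hb] using hab, by simp [hb]⟩
      · exact absurd (by simpa using h) hv

/-- With at least three copies, some copy contains neither root of a good pair. -/
theorem not_goodPair_copies (hK : 2 < Fintype.card K)
    (h : ¬ ∃ O I : Finset (V × V), IsOutBranching Finset.univ A O s ∧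
      IsInBranching Finset.univ A I t ∧ Disjoint O I) :
    ¬ GoodPair Finset.univ (copies A s t σ f) := by
  rintro ⟨I, O, r, q, hI, hO, hd⟩
  obtain ⟨i, -, hi⟩ := Finset.exists_mem_notMem_of_card_lt_card
    (s := {(f r).1, (f q).1}) (t := (Finset.univ : Finset K))
    (Finset.card_le_two.trans_lt (by simpa using hK))
  simp only [Finset.mem_insert, Finset.mem_singleton, not_or] at hi
  exact h ⟨_, _, hO.inCopy (Ne.symm hi.2), hI.inCopy (Ne.symm hi.1), disjoint_inCopy hd.symm⟩

/-- Deleting the arcs of an injective map from a complete digraph on `R + 2` vertices leaves an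
`R`-arc-strong digraph. -/
theorem le_card_cut_ne_injective {R : ℕ} (hK : Fintype.card K = R + 2)
    (hσ : Function.Injective σ) {S : Finset K} (hS : S.Nonempty) (hS' : S ≠ Finset.univ) :
    R ≤ ((S ×ˢ Sᶜ).filter fun e => e.2 ≠ σ e.1).card := by
  have hsplit := Finset.card_filter_add_card_filter_not (s := S ×ˢ Sᶜ) fun e => e.2 = σ e.1
  simp only [Finset.card_product, ← ne_eq] at hsplit
  have htail : ((S ×ˢ Sᶜ).filter fun e => e.2 = σ e.1).card ≤ S.card := by
    refine Finset.card_le_card_of_injOn Prod.fst (fun e he => ?_) ?_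
    · simp at he ⊢; tauto
    · rintro ⟨a, b⟩ h ⟨c, d⟩ h' (rfl : a = c)
      simp at h h'
      simp [h, h']
  have hhead : ((S ×ˢ Sᶜ).filter fun e => e.2 = σ e.1).card ≤ Sᶜ.card := by
    refine Finset.card_le_card_of_injOn Prod.snd (fun e he => ?_) ?_
    · simp at he ⊢; tauto
    · rintro ⟨a, b⟩ h ⟨c, d⟩ h' (rfl : b = d)
      simp at h h'
      simp [hσ (h.2.symm.trans h'.2)]
  have hadd := S.card_add_card_compl
  have h1 : 1 ≤ S.card := hS.card_pos
  have h2 : 1 ≤ Sᶜ.card := by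
    rw [Nat.one_le_iff_ne_zero, Finset.card_ne_zero]
    exact Finset.nonempty_iff_ne_empty.2 (by simpa using hS')
  obtain ⟨a, ha⟩ := Nat.exists_eq_add_of_le h1
  obtain ⟨b, hb⟩ := Nat.exists_eq_add_of_le h2
  rw [ha, hb] at hsplit
  have hR : R = a + b := by omega
  rcases Nat.eq_zero_or_pos b with rfl | hb'
  · omega
  · have := Nat.le_mul_of_pos_right a hb'
    nlinarith

theorem arcConnAtLeast_copies {R : ℕ} (hK : Fintype.card K = R + 2)
    (hσ : Function.Injective σ) (hA : ArcConnAtLeast A R) :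
    ArcConnAtLeast (copies A s t σ f) R := by
  intro X hX hX'
  by_cases hcase : ∃ i, (∃ v, f.symm (i, v) ∈ X) ∧ ∃ v, f.symm (i, v) ∉ X
  · obtain ⟨i, ⟨u, hu⟩, v, hv⟩ := hcase
    refine (hA (Finset.univ.filter fun v => f.symm (i, v) ∈ X) ⟨u, by simpa using hu⟩
      fun h => hv (by simpa using h.ge (Finset.mem_univ v))).trans ?_
    refine Finset.card_le_card_of_injOn (fun e => (f.symm (i, e.1), f.symm (i, e.2))) ?_ ?_
    · rintro ⟨a, b⟩ h
      simpa [mem_copies] using h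
    · rintro ⟨a, b⟩ - ⟨c, d⟩ - h
      simpa using h
  · push Not at hcase
    have hmem : ∀ i u v, f.symm (i, u) ∈ X → f.symm (i, v) ∈ X := fun i u v hu =>
      hcase i ⟨u, hu⟩ v
    set S : Finset K := Finset.univ.filter fun i => f.symm (i, s) ∈ X with hS
    have hSX : ∀ w, (f w).1 ∈ S ↔ w ∈ X := fun w => by
      rw [hS, Finset.mem_filter_univ]
      exact ⟨fun h => by simpa using hmem _ _ (f w).2 h,
        fun h => hmem _ (f w).2 _ (by simpa using h)⟩
    refine (le_card_cut_ne_injective hK hσ (S := S) ?_ ?_).trans ?_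
    · obtain ⟨w, hw⟩ := hX
      exact ⟨_, (hSX w).2 hw⟩
    · exact fun h => hX' (Finset.eq_univ_of_forall fun w => (hSX w).1 (h ▸ Finset.mem_univ _))
    refine Finset.card_le_card_of_injOn (fun e => (f.symm (e.1, t), f.symm (e.2, s))) ?_ ?_
    · rintro ⟨i, j⟩ h
      obtain ⟨⟨hi, hj⟩, hij⟩ : (i ∈ S ∧ j ∉ S) ∧ j ≠ σ i := by simpa using h
      have hne : i ≠ j := fun h => hj (h ▸ hi)
      simp only [Finset.coe_filter, Set.mem_ofPred_eq, mem_copies, ← hSX]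
      simp [hi, hj, hij, hne]
    · rintro ⟨a, b⟩ - ⟨c, d⟩ - h
      simpa using h

theorem arcConnEq_copies {R : ℕ} (hK : Fintype.card K = R + 2) (hσ : Function.Injective σ)
    (hσ' : ∀ i, σ i ≠ i) (hA : ArcConnAtLeast A R) : ArcConnEq (copies A s t σ f) R := by
  have hconn : ArcConnAtLeast (copies A s t σ f) R := arcConnAtLeast_copies hK hσ hA
  refine ⟨hconn, ?_⟩
  obtain ⟨i⟩ : Nonempty K := Fintype.card_pos_iff.1 (by omega)
  have hX : (Finset.univ.filter fun w => (f w).1 = i).Nonempty := ⟨f.symm (i, s), by simp⟩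
  have hX' : (Finset.univ.filter fun w => (f w).1 = i) ≠ Finset.univ := fun h =>
    hσ' i (by simpa using h.ge (Finset.mem_univ (f.symm (σ i, s))))
  refine ⟨_, hX, hX', le_antisymm ?_ (hconn _ hX hX')⟩
  have hcard : ({i, σ i}ᶜ : Finset K).card = R := by
    rw [Finset.card_compl, Finset.card_pair (hσ' i).symm, hK, Nat.add_sub_cancel]
  rw [← hcard]
  refine Finset.card_le_card_of_injOn (fun e => (f e.2).1) ?_ ?_
  · rintro ⟨a, b⟩ h
    simp only [Finset.coe_filter, Set.mem_ofPred_eq, mem_copies, Finset.mem_filter_univ] at h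
    obtain ⟨h, rfl, hb⟩ := h
    simp only [Finset.coe_compl, Set.mem_compl_iff, Finset.mem_coe, Finset.mem_insert,
      Finset.mem_singleton]
    tauto
  · rintro ⟨a, b⟩ h ⟨c, d⟩ h' hbd
    simp only [Finset.coe_filter, Set.mem_ofPred_eq, mem_copies, Finset.mem_filter_univ] at h h'
    have hac : f a = f c := Prod.ext_iff.2 ⟨by grind, by grind⟩
    have hbd : f b = f d := Prod.ext_iff.2 ⟨hbd, by grind⟩
    simp [f.injective hac, f.injective hbd]

end Copies

/-- If some digraph `H` with arc-connectivity `R` has vertices `s, t`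
admitting no arc-disjoint out-branching rooted at `s` and in-branching rooted at `t`,
then some digraph `U` with arc-connectivity `R` has no good pair. -/
theorem stmt12 (R : ℕ)
    (h : ∃ (n : ℕ) (A : Finset (Fin n × Fin n)) (s t : Fin n),
      (∀ e ∈ A, e.1 ≠ e.2) ∧ ArcConnEq A R ∧
      ¬ ∃ O I : Finset (Fin n × Fin n),
          IsOutBranching Finset.univ A O s ∧ IsInBranching Finset.univ A I t ∧
          Disjoint O I) :
    ∃ (m : ℕ) (U : Finset (Fin m × Fin m)),
      (∀ e ∈ U, e.1 ≠ e.2) ∧ ArcConnEq U R ∧ ¬ GoodPair Finset.univ U := by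
  obtain ⟨n, A, s, t, hirr, hconn, hbad⟩ := h
  rcases Nat.eq_zero_or_pos R with rfl | hR
  · refine ⟨2, ∅, by simp, ⟨fun _ _ _ => Nat.zero_le _, {0}, by simp, by decide, rfl⟩, ?_⟩
    rintro ⟨-, O, -, q, -, ⟨-, hO, -, -, hdeg⟩, -⟩
    obtain ⟨v, hv⟩ := exists_ne q
    have := hdeg v (Finset.mem_univ v) hv
    simp [Finset.subset_empty.1 hO] at this
  · have hσ : ∀ i : Fin (R + 2), i + 1 ≠ i := fun i => by simp
    refine ⟨(R + 2) * n, copies A s t (· + 1) finProdFinEquiv.symm, ?_,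
      arcConnEq_copies (Fintype.card_fin _) (add_left_injective 1) hσ hconn.1,
      not_goodPair_copies (by simpa using hR) hbad⟩
    rintro ⟨a, b⟩ hab (rfl : a = b)
    rcases mem_copies.1 hab with ⟨-, h⟩ | ⟨h, -⟩
    · exact hirr _ h rfl
    · exact h rfl
end
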